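/- arXiv:1902.05701 — 3 statements merged into one kernel-verified Lean document; each statement's English description precedes it below -/
import Mathlib

section
/- Every graph with minimum degree at least three contains two cycles whose lengths differ by one or two. -/
/-- A graph has a *good pair* of cycles if it contains two cycles whose
lengths differ by one or two. -/
def HasGoodPair {V : Type*} (G : SimpleGraph V) : Prop :=
  ∃ (u v : V) (c₁ : G.Walk u u) (c₂ : G.Walk v v),
    c₁.IsCycle ∧ c₂.IsCycle ∧
      (c₁.length + 1 = c₂.length ∨ c₁.length + 2 = c₂.length)

open Finset in
theorem acyclic_sum_degrees {W : Type*} [Fintype W] [Nonempty W] (T : SimpleGraph W)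
    [DecidableRel T.Adj] (h : T.IsAcyclic) :
    ∑ v, T.degree v + 2 ≤ 2 * Fintype.card W := by
  classical
  obtain ⟨F, hTF, -, hF⟩ :=
    (SimpleGraph.connected_top (V := W)).exists_isTree_le_of_le_of_isAcyclic (le_top : T ≤ ⊤) h
  have h1 := hF.card_edgeFinset
  have h2 : #T.edgeFinset ≤ #F.edgeFinset :=
    card_le_card (SimpleGraph.edgeFinset_subset_edgeFinset.2 hTF)
  rw [T.sum_degrees_eq_twice_card_edges]
  omega

/-- `S` contains (the support of) a cycle. -/
def CycleIn {V : Type*} (G : SimpleGraph V) (S : Finset V) : Prop :=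
  ∃ (u : V) (c : G.Walk u u), c.IsCycle ∧ ∀ x ∈ c.support, x ∈ S

/-- Degree into `S`. -/
def degIn {V : Type*} (G : SimpleGraph V) [DecidableRel G.Adj] (S : Finset V) (v : V) : ℕ :=
  (S.filter (G.Adj v)).card

theorem sum_degIn_le {V : Type*} [DecidableEq V] (G : SimpleGraph V) [DecidableRel G.Adj]
    (S : Finset V) (hS : S.Nonempty) (h : ¬ CycleIn G S) :
    ∑ v ∈ S, degIn G S v + 2 ≤ 2 * S.card := by
  have : Nonempty S := hS.to_subtype
  have hac : (G.induce (S : Set V)).IsAcyclic := by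
    intro u c hc
    refine h ⟨_, c.map (SimpleGraph.Embedding.induce (S : Set V)).toHom,
      hc.map Subtype.val_injective, ?_⟩
    intro x hx
    rw [SimpleGraph.Walk.support_map, List.mem_map] at hx
    obtain ⟨y, -, rfl⟩ := hx
    exact y.2
  have := acyclic_sum_degrees (W := S) (G.induce (S : Set V)) hac
  rw [Fintype.card_coe] at this
  rw [← Finset.sum_coe_sort S]
  convert this using 3 with v
  rw [← SimpleGraph.card_neighborFinset_eq_degree, degIn]
  symm
  apply Finset.card_bij (fun x _ => x.1)
  · intro a ha
    simp at ha ⊢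
    exact ha
  · intro a _ b _ hab
    exact Subtype.ext hab
  · intro b hb
    simp at hb
    exact ⟨⟨b, hb.1⟩, by simpa using hb.2, rfl⟩

theorem sum_degIn_erase {V : Type*} [DecidableEq V] (G : SimpleGraph V) [DecidableRel G.Adj]
    (S : Finset V) (a : V) (ha : a ∈ S) :
    ∑ v ∈ S.erase a, degIn G S v = ∑ v ∈ S.erase a, degIn G (S.erase a) v + degIn G S a := by
  have h1 : ∀ v ∈ S.erase a, degIn G S v = degIn G (S.erase a) v + if G.Adj a v then 1 else 0 := by
    intro v hv
    unfold degIn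
    rw [Finset.filter_erase]
    by_cases h : G.Adj a v
    · rw [if_pos h, Finset.card_erase_add_one]
      simp [ha, h.symm]
    · rw [if_neg h, Finset.erase_eq_of_notMem]
      · rfl
      · simpa [ha] using fun h' : G.Adj v a => h h'.symm
  rw [Finset.sum_congr rfl h1, Finset.sum_add_distrib, ← Finset.card_filter]
  congr 1
  unfold degIn
  rw [Finset.filter_erase, Finset.erase_eq_of_notMem]
  simp

theorem close_cycle {V : Type*} {G : SimpleGraph V} {H : Set V} {u v h₁ h₂ : V}
    (q : G.Walk h₁ h₂) (hq : q.IsPath) (hqH : ∀ x ∈ q.support, x ∈ H)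
    (r : G.Walk v u) (hr : r.IsPath) (hrH : ∀ x ∈ r.support, x ∉ H)
    (huv : u ≠ v) (a₁ : G.Adj u h₁) (a₂ : G.Adj h₂ v) :
    (SimpleGraph.Walk.cons a₁ (q.append (SimpleGraph.Walk.cons a₂ r))).IsCycle := by
  have hh₁ := hqH _ q.start_mem_support
  have hh₂ := hqH _ q.end_mem_support
  have hu := hrH _ r.end_mem_support
  rw [SimpleGraph.Walk.cons_isCycle_iff]
  constructor
  · rw [SimpleGraph.Walk.isPath_def, SimpleGraph.Walk.support_append,
      SimpleGraph.Walk.support_cons, List.tail_cons, List.nodup_append']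
    exact ⟨hq.support_nodup, hr.support_nodup, fun x hx hx' => hrH x hx' (hqH x hx)⟩
  · rw [SimpleGraph.Walk.edges_append, SimpleGraph.Walk.edges_cons, List.mem_append, List.mem_cons]
    rintro (h | h | h)
    · exact hu (hqH _ (q.fst_mem_support_of_mem_edges h))
    · rw [Sym2.eq_iff] at h
      rcases h with ⟨h, -⟩ | ⟨h, -⟩
      · exact hu (h ▸ hh₂)
      · exact huv h
    · exact hrH _ (r.snd_mem_support_of_mem_edges h) hh₁

theorem good_of_attached {V : Type*} [DecidableEq V] {G : SimpleGraph V} {H : Set V}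
    (hH : ∀ x ∈ H, ∀ y ∈ H, ∃ p : G.Walk x y, ∀ z ∈ p.support, z ∈ H)
    {u : V} (c : G.Walk u u) (hc : c.IsCycle) (hcH : ∀ x ∈ c.support, x ∉ H)
    (hA : ∀ x ∈ c.support, ∃ h ∈ H, G.Adj x h) : HasGoodPair G := by
  have hL := hc.three_le_length
  obtain ⟨m, hm⟩ : ∃ m, m = (c.length - 1) / 2 := ⟨_, rfl⟩
  have hvs : c.getVert m ∈ c.support := c.getVert_mem_support m
  obtain ⟨h₁, hh₁, a₁⟩ := hA u c.start_mem_support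
  obtain ⟨h₂, hh₂, a₂⟩ := hA _ hvs
  obtain ⟨p, hp⟩ := hH h₁ hh₁ h₂ hh₂
  have hq : ∀ x ∈ p.bypass.support, x ∈ H := fun x hx => hp x (p.support_bypass_subset_support hx)
  have huv : u ≠ c.getVert m := by
    intro h
    have := hc.getVert_injOn' (x₁ := 0) (x₂ := m) (by simp) (by simp; omega) (by simpa using h)
    omega
  have t1 : ∀ x ∈ (c.take m).reverse.support, x ∉ H := by
    intro x hx
    rw [SimpleGraph.Walk.support_reverse, List.mem_reverse, SimpleGraph.Walk.support_take] at hx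
    exact hcH x (List.mem_of_mem_take hx)
  have t2 : ∀ x ∈ (c.drop m).support, x ∉ H := by
    intro x hx
    rw [SimpleGraph.Walk.drop_support_eq_support_drop_min] at hx
    exact hcH x (List.mem_of_mem_drop hx)
  refine ⟨_, _, _, _, close_cycle p.bypass p.bypass_isPath hq (c.take m).reverse
    (hc.isPath_take (by omega)).reverse t1 huv a₁ a₂.symm,
    close_cycle p.bypass p.bypass_isPath hq (c.drop m)
    (hc.isPath_drop (by omega)) t2 huv a₁ a₂.symm, ?_⟩
  simp only [SimpleGraph.Walk.length_cons, SimpleGraph.Walk.length_append,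
    SimpleGraph.Walk.length_reverse, SimpleGraph.Walk.take_length, SimpleGraph.Walk.drop_length]
  omega

theorem two_le_degIn {V : Type*} [DecidableEq V] (G : SimpleGraph V) [DecidableRel G.Adj]
    (S : Finset V) {u a : V} (c : G.Walk u u) (hc : c.IsCycle) (hcS : ∀ x ∈ c.support, x ∈ S)
    (ha : a ∈ c.support) : 2 ≤ degIn G S a := by
  have hd := hc.rotate ha
  have hdS : ∀ x ∈ (c.rotate a ha).support, x ∈ S := by
    intro x hx
    exact hcS x ((SimpleGraph.Walk.mem_support_rotate_iff ..).1 hx)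
  generalize c.rotate a ha = d at hd hdS
  have hn : ¬ d.Nil := hd.not_nil
  have hsub : ({d.snd, d.penultimate} : Finset V) ⊆ S.filter (G.Adj a) := by
    intro x hx
    rw [Finset.mem_insert, Finset.mem_singleton] at hx
    rw [Finset.mem_filter]
    rcases hx with rfl | rfl
    · exact ⟨hdS _ (d.getVert_mem_support _), d.adj_snd hn⟩
    · exact ⟨hdS _ (d.getVert_mem_support _), (d.adj_penultimate hn).symm⟩
  have := Finset.card_le_card hsub
  rwa [Finset.card_pair hd.snd_ne_penultimate] at this

/-- The counting step: if each vertex of `A ⊆ K` hits every cycle in `K`, then `A = K`. -/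
theorem count_step {V : Type*} [DecidableEq V] (G : SimpleGraph V) [DecidableRel G.Adj]
    (K A : Finset V) (hAK : A ⊆ K) (hA : A.Nonempty)
    (h2 : ∀ v ∈ A, 2 ≤ degIn G K v) (h3 : ∀ v ∈ K, v ∉ A → 3 ≤ degIn G K v)
    (hac : ∀ a ∈ A, ¬ CycleIn G (K.erase a)) : ∀ x ∈ K, x ∈ A := by
  intro x hxK
  by_contra hxA
  have h2' : ∀ v ∈ K, 2 ≤ degIn G K v := by
    intro v hv
    by_cases h : v ∈ A
    · exact h2 v h
    · have := h3 v hv h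
      omega
  have key : ∀ a ∈ A, ∑ v ∈ K.erase a, (degIn G K v - 2) + 2 ≤ degIn G K a := by
    intro a ha
    have hxa : x ∈ K.erase a := Finset.mem_erase.2 ⟨fun h => hxA (h ▸ ha), hxK⟩
    have e1 := sum_degIn_le G (K.erase a) ⟨x, hxa⟩ (hac a ha)
    have e2 := sum_degIn_erase G K a (hAK ha)
    have e3 : ∑ v ∈ K.erase a, degIn G K v
        = ∑ v ∈ K.erase a, (degIn G K v - 2) + 2 * (K.erase a).card := by
      rw [mul_comm, ← smul_eq_mul, ← Finset.sum_const, ← Finset.sum_add_distrib]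
      refine Finset.sum_congr rfl fun v hv => ?_
      have := h2' v (Finset.mem_of_mem_erase hv)
      omega
    omega
  obtain ⟨a, ha⟩ := hA
  have ka := key a ha
  by_cases hb : ∃ b ∈ A, b ≠ a
  · obtain ⟨b, hb, hba⟩ := hb
    have kb := key b hb
    have h1 : (degIn G K b - 2) + (degIn G K x - 2) ≤ ∑ v ∈ K.erase a, (degIn G K v - 2) := by
      rw [← Finset.sum_pair (f := fun v => degIn G K v - 2) (fun h : b = x => hxA (h ▸ hb))]
      apply Finset.sum_le_sum_of_subset
      intro y hy
      rw [Finset.mem_insert, Finset.mem_singleton] at hy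
      rcases hy with rfl | rfl
      · exact Finset.mem_erase.2 ⟨hba, hAK hb⟩
      · exact Finset.mem_erase.2 ⟨fun h => hxA (h ▸ ha), hxK⟩
    have h1' : degIn G K a - 2 ≤ ∑ v ∈ K.erase b, (degIn G K v - 2) :=
      Finset.single_le_sum (f := fun v => degIn G K v - 2) (fun _ _ => Nat.zero_le _)
        (Finset.mem_erase.2 ⟨hba.symm, hAK ha⟩)
    have := h3 x hxK hxA
    have := h2 a ha
    have := h2 b hb
    omega
  · push Not at hb
    have h1 : (K.erase a).card ≤ ∑ v ∈ K.erase a, (degIn G K v - 2) := by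
      rw [Finset.card_eq_sum_ones]
      refine Finset.sum_le_sum fun v hv => ?_
      have hv' := Finset.mem_erase.1 hv
      have := h3 v hv'.2 (fun h => hv'.1 (hb v h))
      omega
    have h4 : degIn G K a ≤ (K.erase a).card := by
      apply Finset.card_le_card
      intro y hy
      rw [Finset.mem_filter] at hy
      exact Finset.mem_erase.2 ⟨hy.2.ne', hy.1⟩
    omega

/-- Every graph with minimum degree at least three contains two cycles whose
lengths differ by one or two. -/
theorem erdos_question {V : Type*} [Fintype V] [DecidableEq V]
    (G : SimpleGraph V) [DecidableRel G.Adj]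
    (hdeg : 3 ≤ G.minDegree) :
    HasGoodPair G := by
  classical
  have hd : ∀ v, 3 ≤ G.degree v := fun v => hdeg.trans (G.minDegree_le_degree v)
  have hne : Nonempty V := by
    by_contra h
    rw [not_nonempty_iff] at h
    rw [SimpleGraph.minDegree_of_subsingleton] at hdeg
    omega
  obtain ⟨v₀⟩ := hne
  -- the component of `v₀`
  obtain ⟨U, hU⟩ : ∃ U : Finset V, ∀ x, x ∈ U ↔ G.Reachable v₀ x :=
    ⟨Finset.univ.filter (G.Reachable v₀), by simp⟩
  have hUadj : ∀ x ∈ U, ∀ y, G.Adj x y → y ∈ U := by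
    intro x hx y hxy
    exact (hU y).2 (((hU x).1 hx).trans hxy.reachable)
  have hv₀ : v₀ ∈ U := (hU v₀).2 (SimpleGraph.Reachable.refl v₀)
  have hdU : ∀ x ∈ U, 3 ≤ degIn G U x := by
    intro x hx
    refine (hd x).trans ?_
    rw [← SimpleGraph.card_neighborFinset_eq_degree]
    apply Finset.card_le_card
    intro y hy
    rw [SimpleGraph.mem_neighborFinset] at hy
    exact Finset.mem_filter.2 ⟨hUadj x hx y hy, hy⟩
  let P : Finset V → Prop := fun H => v₀ ∈ H ∧
    (∀ x ∈ H, ∀ y ∈ H, ∃ p : G.Walk x y, ∀ z ∈ p.support, z ∈ H) ∧ CycleIn G (U \ H)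
  have hP0 : P {v₀} := by
    refine ⟨by simp, ?_, ?_⟩
    · intro x hx y hy
      rw [Finset.mem_singleton] at hx hy
      subst hx hy
      exact ⟨SimpleGraph.Walk.nil, by simp⟩
    · rw [Finset.sdiff_singleton_eq_erase]
      by_contra hcon
      have e0 : (U.erase v₀).Nonempty := by
        have h1 : 0 < degIn G U v₀ := by have := hdU v₀ hv₀; omega
        obtain ⟨y, hy⟩ := Finset.card_pos.1 h1
        rw [Finset.mem_filter] at hy
        exact ⟨y, Finset.mem_erase.2 ⟨hy.2.ne', hy.1⟩⟩
      have e1 := sum_degIn_le G _ e0 hcon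
      have e2 : ∑ v ∈ U.erase v₀, 2 ≤ ∑ v ∈ U.erase v₀, degIn G (U.erase v₀) v := by
        refine Finset.sum_le_sum fun v hv => ?_
        have := hdU v (Finset.mem_of_mem_erase hv)
        unfold degIn at this ⊢
        rw [Finset.filter_erase]
        have := Finset.pred_card_le_card_erase (s := U.filter (G.Adj v)) (a := v₀)
        omega
      rw [Finset.sum_const, smul_eq_mul] at e2
      omega
  obtain ⟨H, hHmem, hmax⟩ := Finset.exists_max_image (Finset.univ.filter P) Finset.card
    ⟨{v₀}, by simpa using hP0⟩
  have hH : P H := (Finset.mem_filter.1 hHmem).2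
  obtain ⟨hvH, hconn, u, c, hc, hcK⟩ := hH
  let A : Finset V := (U \ H).filter (fun x => ∃ h ∈ H, G.Adj x h)
  have hext : ∀ a ∈ A, ¬ CycleIn G ((U \ H).erase a) := by
    intro a ha hcyc
    obtain ⟨haK, h, hhH, hah⟩ := Finset.mem_filter.1 ha
    have haH : a ∉ H := (Finset.mem_sdiff.1 haK).2
    have hnew : P (insert a H) := by
      refine ⟨Finset.mem_insert_of_mem hvH, ?_, ?_⟩
      · have hto : ∀ x ∈ insert a H, ∃ p : G.Walk x h, ∀ z ∈ p.support, z ∈ insert a H := by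
          intro x hx
          rcases Finset.mem_insert.1 hx with rfl | hx
          · refine ⟨SimpleGraph.Walk.cons hah SimpleGraph.Walk.nil, ?_⟩
            intro z hz
            simp at hz
            rcases hz with rfl | rfl <;> simp [hhH]
          · obtain ⟨p, hp⟩ := hconn x hx h hhH
            exact ⟨p, fun z hz => Finset.mem_insert_of_mem (hp z hz)⟩
        intro x hx y hy
        obtain ⟨p, hp⟩ := hto x hx
        obtain ⟨q, hq⟩ := hto y hy
        refine ⟨p.append q.reverse, fun z hz => ?_⟩
        rw [SimpleGraph.Walk.mem_support_append_iff, SimpleGraph.Walk.support_reverse,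
          List.mem_reverse] at hz
        exact hz.elim (hp z) (hq z)
      · have : U \ insert a H = (U \ H).erase a := by
          ext y
          simp only [Finset.mem_sdiff, Finset.mem_insert, Finset.mem_erase]
          tauto
        rw [this]
        exact hcyc
    have := hmax _ (Finset.mem_filter.2 ⟨Finset.mem_univ _, hnew⟩)
    rw [Finset.card_insert_of_notMem haH] at this
    omega
  have hAne : A.Nonempty := by
    have hu := Finset.mem_sdiff.1 (hcK u c.start_mem_support)
    obtain ⟨w⟩ := (hU u).1 hu.1
    obtain ⟨d, -, hd1, hd2⟩ := w.exists_boundary_dart (H : Set V) hvH hu.2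
    obtain ⟨p, -⟩ := hconn v₀ hvH d.fst hd1
    exact ⟨d.snd, Finset.mem_filter.2 ⟨Finset.mem_sdiff.2
      ⟨hUadj _ ((hU _).2 ⟨p⟩) _ d.adj, hd2⟩, d.fst, hd1, d.adj.symm⟩⟩
  have hall := count_step G (U \ H) A (Finset.filter_subset _ _) hAne
    (by
      intro a ha
      refine two_le_degIn G _ c hc hcK ?_
      by_contra hac
      exact hext a ha ⟨u, c, hc, fun x hx =>
        Finset.mem_erase.2 ⟨fun h => hac (h ▸ hx), hcK x hx⟩⟩)
    (by
      intro v hv hvA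
      refine (hdU v (Finset.mem_sdiff.1 hv).1).trans (Finset.card_le_card ?_)
      intro y hy
      rw [Finset.mem_filter] at hy ⊢
      refine ⟨Finset.mem_sdiff.2 ⟨hy.1, fun hyH => hvA ?_⟩, hy.2⟩
      exact Finset.mem_filter.2 ⟨hv, y, hyH, hy.2⟩)
    hext
  exact good_of_attached (H := (H : Set V)) hconn c hc
    (fun x hx => (Finset.mem_sdiff.1 (hcK x hx)).2)
    (fun x hx => (Finset.mem_filter.1 (hall x (hcK x hx))).2)
end

section
/- Let G be an n-vertex graph with minimum degree at least three, where n ≥ 45. Then after deleting any set of at most √n/5 edges from G, the remaining graph still contains two cycles whose lengths differ by one or two. -/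
namespace Resil

/-- A cycle of length `m`, as a periodic function on the integers. -/
structure IsCyc {V : Type*} (G : SimpleGraph V) (m : ℕ) (c : ℤ → V) : Prop where
  three : 3 ≤ m
  adj : ∀ i, G.Adj (c i) (c (i + 1))
  inj : ∀ i j, c i = c j ↔ (m : ℤ) ∣ j - i

/-- No two cycles whose lengths differ by one or two. -/
def NoGP {V : Type*} (G : SimpleGraph V) : Prop :=
  ∀ m₁ m₂ c₁ c₂, IsCyc G m₁ c₁ → IsCyc G m₂ c₂ → m₂ ≠ m₁ + 1 ∧ m₂ ≠ m₁ + 2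

/-- Reachability inside a set. -/
def Rch {V : Type*} (G : SimpleGraph V) (T : Set V) (u v : V) : Prop :=
  ∃ p : G.Walk u v, ∀ x ∈ p.support, x ∈ T

section basic
variable {V : Type*} {G : SimpleGraph V}

theorem Rch.refl {T : Set V} {u : V} (h : u ∈ T) : Rch G T u u :=
  ⟨SimpleGraph.Walk.nil, by simpa using h⟩

theorem Rch.symm {T : Set V} {u v : V} (h : Rch G T u v) : Rch G T v u := by
  obtain ⟨p, hp⟩ := h
  exact ⟨p.reverse, by simpa using hp⟩

theorem Rch.trans {T : Set V} {u v w : V} (h : Rch G T u v) (h' : Rch G T v w) :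
    Rch G T u w := by
  obtain ⟨p, hp⟩ := h
  obtain ⟨q, hq⟩ := h'
  refine ⟨p.append q, fun x hx => ?_⟩
  rw [SimpleGraph.Walk.mem_support_append_iff] at hx
  exact hx.elim (hp x) (hq x)

theorem Rch.mono {T T' : Set V} (hT : T ⊆ T') {u v : V} (h : Rch G T u v) : Rch G T' u v := by
  obtain ⟨p, hp⟩ := h
  exact ⟨p, fun x hx => hT (hp x hx)⟩

theorem Rch.left {T : Set V} {u v : V} (h : Rch G T u v) : u ∈ T := by
  obtain ⟨p, hp⟩ := h
  exact hp _ p.start_mem_support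

theorem Rch.right {T : Set V} {u v : V} (h : Rch G T u v) : v ∈ T := by
  obtain ⟨p, hp⟩ := h
  exact hp _ p.end_mem_support

theorem Rch.of_adj {T : Set V} {u v : V} (h : G.Adj u v) (hu : u ∈ T) (hv : v ∈ T) :
    Rch G T u v := by
  refine ⟨SimpleGraph.Walk.cons h SimpleGraph.Walk.nil, ?_⟩
  simp [hu, hv]

theorem Rch.snoc {T : Set V} {u v w : V} (h : Rch G T u v) (h' : G.Adj v w) (hw : w ∈ T) :
    Rch G T u w := h.trans (Rch.of_adj h' h.right hw)

theorem Rch.exists_path {T : Set V} {u v : V} (h : Rch G T u v) :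
    ∃ p : G.Walk u v, p.IsPath ∧ ∀ x ∈ p.support, x ∈ T := by
  classical
  obtain ⟨p, hp⟩ := h
  exact ⟨p.bypass, p.bypass_isPath, fun x hx => hp x (p.support_bypass_subset_support hx)⟩

/-- A closed property along walks. -/
theorem Rch.closed {T : Set V} {D : Set V} {u v : V} (h : Rch G T u v) (hu : u ∈ D)
    (hD : ∀ x ∈ D, ∀ y ∈ T, G.Adj x y → y ∈ D) : v ∈ D := by
  obtain ⟨p, hp⟩ := h
  induction p with
  | nil => exact hu
  | cons hadj p ih =>
    refine ih (hD _ hu _ (hp _ (by simp)) hadj) (fun x hx => hp x (by simp [hx]))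

theorem mkCyc {M : ℕ} (hM : 3 ≤ M) (f : ℕ → V)
    (hinj : ∀ a b, a < M → b < M → f a = f b → a = b)
    (hadj : ∀ k, k + 1 < M → G.Adj (f k) (f (k + 1)))
    (hlast : G.Adj (f (M - 1)) (f 0)) :
    ∃ z, IsCyc G M z ∧ (∀ k : ℕ, k < M → z k = f k) ∧ (∀ i, ∃ k, k < M ∧ z i = f k) := by
  have hM0 : (0 : ℤ) < M := by omega
  refine ⟨fun i => f (i % (M : ℤ)).toNat, ⟨hM, ?_, ?_⟩, ?_, ?_⟩
  · intro i
    have h1 := Int.emod_nonneg i hM0.ne'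
    have h2 := Int.emod_lt_of_pos i hM0
    show G.Adj (f (i % (M : ℤ)).toNat) (f ((i + 1) % (M : ℤ)).toNat)
    rcases lt_or_ge (i % (M : ℤ) + 1) M with h | h
    · have h3 : (i + 1) % (M : ℤ) = i % (M : ℤ) + 1 := by
        rw [← Int.emod_emod_of_dvd (i+1) (dvd_refl (M : ℤ)), Int.add_emod]
        have : (1 : ℤ) % M = 1 := Int.emod_eq_of_lt (by omega) (by omega)
        rw [this, Int.emod_emod_of_dvd _ (dvd_refl _)]
        exact Int.emod_eq_of_lt (by omega) h
      rw [h3]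
      have : (i % (M : ℤ) + 1).toNat = (i % (M : ℤ)).toNat + 1 := by omega
      rw [this]
      exact hadj _ (by omega)
    · have h4 : i % (M : ℤ) = M - 1 := by omega
      have h3 : (i + 1) % (M : ℤ) = 0 := by
        rw [← Int.emod_emod_of_dvd (i+1) (dvd_refl (M : ℤ)), Int.add_emod, h4]
        have : (1 : ℤ) % M = 1 := Int.emod_eq_of_lt (by omega) (by omega)
        rw [this]; simp
      rw [h3, h4]
      have : ((M : ℤ) - 1).toNat = M - 1 := by omega
      rw [this]
      exact hlast
  · intro i j
    have h1 := Int.emod_nonneg i hM0.ne'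
    have h2 := Int.emod_lt_of_pos i hM0
    have h1' := Int.emod_nonneg j hM0.ne'
    have h2' := Int.emod_lt_of_pos j hM0
    constructor
    · intro h
      have := hinj _ _ (by omega) (by omega) h
      have h5 : i % (M : ℤ) = j % (M : ℤ) := by omega
      exact Int.ModEq.dvd h5
    · intro h
      have h5 : i % (M : ℤ) = j % (M : ℤ) := (Int.modEq_iff_dvd.mpr h)
      show f _ = f _
      rw [h5]
  · intro k hk
    have : ((k : ℤ) % (M : ℤ)).toNat = k := by
      rw [Int.emod_eq_of_lt (by omega) (by omega)]; omega
    show f _ = f _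
    rw [this]
  · intro i
    have h1 := Int.emod_nonneg i hM0.ne'
    have h2 := Int.emod_lt_of_pos i hM0
    exact ⟨_, by omega, rfl⟩

theorem small_dvd {m : ℕ} {x : ℤ} (h : (m : ℤ) ∣ x) (h1 : -(m : ℤ) < x) (h2 : x < m) : x = 0 :=
  Int.eq_zero_of_abs_lt_dvd h (abs_lt.mpr ⟨h1, h2⟩)

theorem IsCyc.inj_window {m : ℕ} {c : ℤ → V} (hc : IsCyc G m c) {i j : ℤ} (h : c i = c j)
    (h1 : -(m : ℤ) < j - i) (h2 : j - i < m) : i = j := by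
  have := small_dvd ((hc.inj i j).1 h) h1 h2
  omega

theorem IsCyc.period {m : ℕ} {c : ℤ → V} (hc : IsCyc G m c) (i : ℤ) : c (i + m) = c i := by
  rw [hc.inj]; exact ⟨-1, by ring⟩

theorem IsCyc.shift {m : ℕ} {c : ℤ → V} (hc : IsCyc G m c) (k : ℤ) :
    IsCyc G m (fun i => c (k + i)) := by
  refine ⟨hc.three, fun i => ?_, fun i j => ?_⟩
  · have := hc.adj (k + i)
    rwa [add_assoc] at this
  · rw [hc.inj]
    have : k + j - (k + i) = j - i := by ring
    rw [this]

/-- every index can be moved into a window -/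
theorem IsCyc.exists_window {m : ℕ} {c : ℤ → V} (hc : IsCyc G m c) (i j : ℤ) :
    ∃ d : ℕ, d < m ∧ c j = c (i + d) ∧ (m : ℤ) ∣ (i + d) - j := by
  have hm := hc.three
  have hM0 : (0 : ℤ) < m := by omega
  have h1 := Int.emod_nonneg (j - i) hM0.ne'
  have h2 := Int.emod_lt_of_pos (j - i) hM0
  have h3 : (m : ℤ) ∣ (i + ((j - i) % (m : ℤ)).toNat) - j := by
    have := Int.emod_add_mul_ediv (j - i) m
    refine ⟨-((j - i) / m), ?_⟩
    have h4 : ((((j - i) % (m : ℤ)).toNat : ℕ) : ℤ) = (j - i) % m := Int.toNat_of_nonneg h1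
    rw [h4]
    linear_combination this
  exact ⟨((j - i) % (m : ℤ)).toNat, by omega, (hc.inj _ _).2 h3, h3⟩

/-- Ear lemma. -/
theorem IsCyc.ear {m : ℕ} {c : ℤ → V} (hc : IsCyc G m c) (i : ℤ) (d : ℕ) (hd : 0 < d)
    (hdm : d < m) {v' v : V} (q : G.Walk v' v) (hq : q.IsPath)
    (hdisj : ∀ x ∈ q.support, ∀ k, x ≠ c k) (h1 : G.Adj (c (i + d)) v')
    (h2 : G.Adj v (c i)) :
    ∃ z, IsCyc G (d + q.length + 2) z ∧ (∀ k : ℕ, k ≤ d → z k = c (i + k)) ∧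
      ∀ k, z k ∈ q.support ∨ ∃ j : ℕ, j ≤ d ∧ z k = c (i + j) := by
  classical
  have H := mkCyc (G := G) (M := d + q.length + 2) (by omega)
    (fun r => if r ≤ d then c (i + r) else q.getVert (r - d - 1))
  specialize H ?_ ?_ ?_
  rotate_left 3
  · obtain ⟨z, hz, hz1, hz2⟩ := H
    refine ⟨z, hz, fun k hk => ?_, fun k => ?_⟩
    · rw [hz1 k (by omega)]; simp [hk]
    · obtain ⟨r, hr, h⟩ := hz2 k
      rw [h]
      by_cases hrd : r ≤ d
      · right; exact ⟨r, hrd, by simp [hrd]⟩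
      · left; simp only [hrd, if_false]; exact q.getVert_mem_support _
  · intro a b ha hb hab
    split_ifs at hab with h3 h4 h4
    · have := hc.inj_window hab (by omega) (by omega); omega
    · exact absurd hab.symm (hdisj _ (q.getVert_mem_support _) _)
    · exact absurd hab (hdisj _ (q.getVert_mem_support _) _)
    · have := hq.getVert_injOn (by simp; omega) (by simp; omega) hab
      omega
  · intro k hk
    split_ifs with h3 h4 h4
    · have := hc.adj (i + k)
      push_cast
      rwa [← add_assoc]
    · have : k = d := by omega
      subst this
      simpa using h1
    · omega
    · have h5 : k + 1 - d - 1 = (k - d - 1) + 1 := by omega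
      rw [h5]
      exact q.adj_getVert_succ (by omega)
  · have h5 : ¬ (d + q.length + 2 - 1 ≤ d) := by omega
    have h6 : d + q.length + 2 - 1 - d - 1 = q.length := by omega
    simp only [h5, if_false, h6]
    simpa using h2

/-- Chord lemma. -/
theorem IsCyc.chord {m : ℕ} {c : ℤ → V} (hc : IsCyc G m c) (i : ℤ) (d : ℕ) (hd : 2 ≤ d)
    (hdm : d < m) (h1 : G.Adj (c (i + d)) (c i)) :
    ∃ z, IsCyc G (d + 1) z ∧ ∀ k, ∃ j : ℕ, j ≤ d ∧ z k = c (i + j) := by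
  have H := mkCyc (G := G) (M := d + 1) (by omega) (fun r => c (i + r))
  specialize H ?_ ?_ ?_
  rotate_left 3
  · obtain ⟨z, hz, hz1, hz2⟩ := H
    refine ⟨z, hz, fun k => ?_⟩
    obtain ⟨r, hr, h⟩ := hz2 k
    exact ⟨r, by omega, h⟩
  · intro a b ha hb hab
    have := hc.inj_window hab (by omega) (by omega); omega
  · intro k hk
    have := hc.adj (i + k)
    push_cast
    rwa [← add_assoc]
  · simpa using h1

/-- No good pair: no outside link between almost antipodal vertices. -/
theorem NoGP.no_link (hG : NoGP G) {m : ℕ} {c : ℤ → V} (hc : IsCyc G m c) {T : Set V}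
    (hT : ∀ x ∈ T, ∀ k, x ≠ c k) (i : ℤ) {v w : V} (hvw : Rch G T v w)
    (h1 : G.Adj v (c i)) (h2 : G.Adj w (c (i + ((m - 1) / 2 : ℕ)))) : False := by
  have hm := hc.three
  set d : ℕ := (m - 1) / 2 with hd
  obtain ⟨p, hp, hpT⟩ := hvw.exists_path
  obtain ⟨z, hz, -⟩ := hc.ear i d (by omega) (by omega) p.reverse hp.reverse
    (fun x hx => hT x (hpT x (by simpa using hx))) h2.symm h1
  have e : i + d + ((m - d : ℕ) : ℤ) = i + m := by push_cast [show d ≤ m by omega]; ring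
  obtain ⟨z', hz', -⟩ := hc.ear (i + d) (m - d) (by omega) (by omega) p hp
    (fun x hx => hT x (hpT x hx)) (by rw [e, hc.period]; exact h1.symm) h2
  have := hG _ _ _ _ hz hz'
  simp only [SimpleGraph.Walk.length_reverse] at this
  omega

theorem IsCyc.exists_walk {m : ℕ} {c : ℤ → V} (hc : IsCyc G m c) :
    ∃ (u : V) (w : G.Walk u u), w.IsCycle ∧ w.length = m := by
  have hm := hc.three
  have key : ∀ n : ℕ, n < m → ∃ p : G.Walk (c 0) (c n), p.IsPath ∧ p.length = n ∧
      ∀ x ∈ p.support, ∃ k : ℕ, k ≤ n ∧ x = c k := by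
    intro n
    induction n with
    | zero => intro _; exact ⟨SimpleGraph.Walk.nil, by simp, by simp, by simp⟩
    | succ n ih =>
      intro hn
      obtain ⟨p, hp, hl, hs⟩ := ih (by omega)
      have ha : G.Adj (c n) (c ((n + 1 : ℕ) : ℤ)) := by
        have := hc.adj n
        push_cast; exact this
      refine ⟨p.concat ha, hp.concat ?_ ha, by simp [hl], ?_⟩
      · intro hx
        obtain ⟨k, hk, hk'⟩ := hs _ hx
        have := hc.inj_window hk' (by push_cast; omega) (by push_cast; omega)
        omega
      · intro x hx
        rw [SimpleGraph.Walk.support_concat] at hx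
        simp only [List.mem_append, List.mem_singleton] at hx
        rcases hx with hx | hx
        · obtain ⟨k, hk, hk'⟩ := hs _ hx
          exact ⟨k, by omega, hk'⟩
        · exact ⟨n + 1, le_rfl, hx⟩
  obtain ⟨p, hp, hl, -⟩ := key (m - 1) (by omega)
  have ha : G.Adj (c ((m - 1 : ℕ) : ℤ)) (c 0) := by
    have h1 := hc.adj ((m - 1 : ℕ) : ℤ)
    have h2 : (((m - 1 : ℕ) : ℤ) + 1) = 0 + m := by omega
    rwa [h2, hc.period] at h1
  refine ⟨_, SimpleGraph.Walk.cons ha p, ?_, by simp [hl]; omega⟩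
  rw [SimpleGraph.Walk.isCycle_iff_isPath_tail_and_le_length]
  refine ⟨by simpa using hp, by simp [hl]; omega⟩

theorem noGP_of_not (h : ¬ HasGoodPair G) : NoGP G := by
  intro m₁ m₂ c₁ c₂ h1 h2
  obtain ⟨u, w, hw, hl⟩ := h1.exists_walk
  obtain ⟨u', w', hw', hl'⟩ := h2.exists_walk
  constructor
  · intro h3
    exact h ⟨u, u', w, w', hw, hw', Or.inl (by omega)⟩
  · intro h3
    exact h ⟨u, u', w, w', hw, hw', Or.inr (by omega)⟩

end basic

section degrees
variable {V : Type*} (G : SimpleGraph V)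

open Classical in
/-- Degree into a finite set. -/
noncomputable def dg (W : Finset V) (v : V) : ℕ := (W.filter (fun u => G.Adj v u)).card

/-- Total deficiency of the graph induced on `W`. -/
noncomputable def df (W : Finset V) : ℕ := ∑ v ∈ W, (3 - dg G W v)

open Classical in
/-- Keep `T` and those vertices of `A` which have at least two neighbours in `T`. -/
noncomputable def red (T A : Finset V) : Finset V := T ∪ A.filter (fun a => 2 ≤ dg G T a)

variable {G}

theorem dg_mono {W W' : Finset V} (h : W ⊆ W') (v : V) : dg G W v ≤ dg G W' v := by
  classical
  exact Finset.card_le_card (Finset.filter_subset_filter _ h)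

theorem subset_red {T A : Finset V} : T ⊆ red G T A := by
  classical
  exact Finset.subset_union_left

theorem mem_red {T A : Finset V} {x : V} : x ∈ red G T A ↔ x ∈ T ∨ (x ∈ A ∧ 2 ≤ dg G T x) := by
  classical
  simp [red]

theorem exists_of_dg {W : Finset V} {v : V} {S : Finset V} (h : S.card < dg G W v) :
    ∃ u ∈ W, G.Adj v u ∧ u ∉ S := by
  classical
  obtain ⟨u, hu, hu'⟩ := Finset.exists_mem_notMem_of_card_lt_card h
  simp only [Finset.mem_filter] at hu
  exact ⟨u, hu.1, hu.2, hu'⟩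

theorem dg_sum (T A : Finset V) : ∑ v ∈ T, dg G A v = ∑ a ∈ A, dg G T a := by
  classical
  have := Finset.sum_card_bipartiteAbove_eq_sum_card_bipartiteBelow (s := T) (t := A)
    (fun x y => G.Adj x y)
  simp only [Finset.bipartiteAbove, Finset.bipartiteBelow] at this
  simp only [dg]
  rw [this]
  refine Finset.sum_congr rfl fun a _ => ?_
  congr 1
  ext x
  simp [G.adj_comm]

open Classical in
theorem reduce {W T A : Finset V} (hTW : T ⊆ W) (hTA : Disjoint T A)
    (hN : ∀ v ∈ T, ∀ u ∈ W, G.Adj v u → u ∈ T ∨ u ∈ A) :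
    df G (red G T A) ≤ ∑ v ∈ T, (3 - dg G W v) + A.card ∧
    (∑ v ∈ T, (3 - dg G W v) + A.card ≤ df G (red G T A) →
      (∀ v ∈ T, 3 - dg G (red G T A) v =
        (3 - dg G W v) + dg G (A.filter (fun a => ¬ 2 ≤ dg G T a)) v) ∧
      (∀ u ∈ A, 2 ≤ dg G T u → 3 - dg G (red G T A) u = 1)) := by
  set B := A.filter (fun a => 2 ≤ dg G T a) with hB
  set A1 := A.filter (fun a => ¬ 2 ≤ dg G T a) with hA1
  have hcard : B.card + A1.card = A.card := Finset.card_filter_add_card_filter_not _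
  have hred : red G T A = T ∪ B := rfl
  have hdisj : Disjoint T B := Finset.disjoint_of_subset_right (Finset.filter_subset _ _) hTA
  have hdf : df G (red G T A) = ∑ v ∈ T, (3 - dg G (red G T A) v) +
      ∑ v ∈ B, (3 - dg G (red G T A) v) := by
    rw [df, ← Finset.sum_union hdisj]
    rfl
  have hp : ∀ v ∈ T, 3 - dg G (red G T A) v ≤ (3 - dg G W v) + dg G A1 v := by
    intro v hv
    have : dg G W v ≤ dg G (red G T A) v + dg G A1 v := by
      unfold dg
      rw [hred]
      refine le_trans (Finset.card_le_card ?_) (Finset.card_union_le _ _)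
      intro u hu
      simp only [Finset.mem_filter, Finset.mem_union] at hu ⊢
      rcases hN v hv u hu.1 hu.2 with h | h
      · exact Or.inl ⟨Or.inl h, hu.2⟩
      · by_cases h2 : 2 ≤ dg G T u
        · exact Or.inl ⟨Or.inr (by simp [hB, h, h2]), hu.2⟩
        · exact Or.inr ⟨by simp only [hA1, Finset.mem_filter]; exact ⟨h, h2⟩, hu.2⟩
    omega
  have hq : ∀ v ∈ B, 3 - dg G (red G T A) v ≤ 1 := by
    intro v hv
    have h1 : 2 ≤ dg G T v := (Finset.mem_filter.1 hv).2
    have h2 : dg G T v ≤ dg G (red G T A) v := dg_mono subset_red v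
    omega
  have hsum1 : ∑ v ∈ T, (3 - dg G (red G T A) v) ≤ ∑ v ∈ T, ((3 - dg G W v) + dg G A1 v) :=
    Finset.sum_le_sum hp
  have hsum2 : ∑ v ∈ T, dg G A1 v ≤ A1.card := by
    rw [dg_sum]
    calc ∑ a ∈ A1, dg G T a ≤ ∑ a ∈ A1, 1 := by
          refine Finset.sum_le_sum fun a ha => ?_
          have := (Finset.mem_filter.1 ha).2
          omega
      _ = A1.card := by simp
  have hsum3 : ∑ v ∈ B, (3 - dg G (red G T A) v) ≤ ∑ v ∈ B, 1 := Finset.sum_le_sum hq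
  have hsum4 : ∑ v ∈ B, 1 = B.card := by simp
  have hsum5 : ∑ v ∈ T, ((3 - dg G W v) + dg G A1 v) =
    ∑ v ∈ T, (3 - dg G W v) + ∑ v ∈ T, dg G A1 v := Finset.sum_add_distrib
  refine ⟨by omega, fun h => ⟨?_, ?_⟩⟩
  · exact (Finset.sum_eq_sum_iff_of_le hp).1 (by omega)
  · intro u hu hu2
    exact (Finset.sum_eq_sum_iff_of_le hq).1 (by omega) u (by simp [hB, hu, hu2])

theorem exists_cyc {W : Finset V} (hW : W.Nonempty) (hdeg : ∀ v ∈ W, 2 ≤ dg G W v) :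
    ∃ m c, IsCyc G m c ∧ ∀ i, c i ∈ W := by
  classical
  by_contra hno
  have key : ∀ n : ℕ, ∃ f : ℕ → V, (∀ a b, a ≤ n → b ≤ n → f a = f b → a = b) ∧
      (∀ k, k < n → G.Adj (f k) (f (k + 1))) ∧ ∀ k ≤ n, f k ∈ W := by
    intro n
    induction n with
    | zero =>
      obtain ⟨w, hw⟩ := hW
      exact ⟨fun _ => w, by intros; omega, by intros; omega, fun _ _ => hw⟩
    | succ n ih =>
      obtain ⟨f, h1, h2, h3⟩ := ih
      obtain ⟨u, huW, hu, hu'⟩ := exists_of_dg (G := G) (W := W) (v := f n) (S := {f (n - 1)})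
        (by have := hdeg (f n) (h3 n le_rfl); simp; omega)
      by_cases hex : ∃ j, j ≤ n ∧ u = f j
      · exfalso
        obtain ⟨j, hj, rfl⟩ := hex
        have hjn : j ≠ n := fun h => by subst h; exact G.loopless.irrefl _ hu
        have hjn' : j ≠ n - 1 := fun h => by subst h; simp at hu'
        have H := mkCyc (G := G) (M := n - j + 1) (by omega) (fun r => f (j + r))
        specialize H ?_ ?_ ?_
        · intro a b ha hb hab
          have := h1 _ _ (by omega) (by omega) hab
          omega
        · intro k hk
          exact h2 _ (by omega)
        · have : j + (n - j + 1 - 1) = n := by omega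
          rw [this]; simpa using hu
        obtain ⟨z, hz, -, hz2⟩ := H
        refine hno ⟨_, z, hz, fun i => ?_⟩
        obtain ⟨k, hk, hk'⟩ := hz2 i
        rw [hk']
        exact h3 _ (by omega)
      · push Not at hex
        refine ⟨fun k => if k ≤ n then f k else u, ?_, ?_, ?_⟩
        · intro a b ha hb hab
          dsimp only at hab
          split_ifs at hab with h4 h5 h5
          · exact h1 _ _ h4 h5 hab
          · exact absurd hab.symm (hex _ h4)
          · exact absurd hab (hex _ h5)
          · omega
        · intro k hk
          rcases Nat.lt_or_ge k n with h | h
          · simp only [show k ≤ n by omega, show k + 1 ≤ n by omega, if_true]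
            exact h2 _ h
          · have : k = n := by omega
            subst this
            simpa using hu
        · intro k _
          dsimp only
          split_ifs with h4
          · exact h3 _ h4
          · exact huW
  obtain ⟨f, h1, -, h3⟩ := key W.card
  have h4 : ((Finset.range (W.card + 1)).image f).card = W.card + 1 := by
    rw [Finset.card_image_of_injOn, Finset.card_range]
    intro a ha b hb hab
    simp at ha hb
    exact h1 _ _ (by omega) (by omega) hab
  have h5 : (Finset.range (W.card + 1)).image f ⊆ W := by
    intro x hx
    simp only [Finset.mem_image, Finset.mem_range] at hx
    obtain ⟨a, ha, rfl⟩ := hx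
    exact h3 _ (by omega)
  have := Finset.card_le_card h5
  omega

open Classical in
/-- The vertex set of a cycle. -/
noncomputable def cs (m : ℕ) (c : ℤ → V) : Finset V := (Finset.range m).image (fun k : ℕ => c k)

theorem mem_cs {m : ℕ} {c : ℤ → V} (hc : IsCyc G m c) {x : V} : x ∈ cs m c ↔ ∃ k, x = c k := by
  classical
  simp only [cs, Finset.mem_image, Finset.mem_range]
  constructor
  · rintro ⟨k, -, rfl⟩; exact ⟨_, rfl⟩
  · rintro ⟨k, rfl⟩
    obtain ⟨d, hd, h, -⟩ := hc.exists_window 0 k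
    exact ⟨d, hd, by rw [h]; simp⟩

theorem card_cs {m : ℕ} {c : ℤ → V} (hc : IsCyc G m c) : (cs m c).card = m := by
  classical
  rw [cs, Finset.card_image_of_injOn, Finset.card_range]
  intro a ha b hb hab
  simp at ha hb
  have := hc.inj_window hab (by omega) (by omega)
  omega

variable (G) in
/-- `W` splits into two smaller pieces. -/
def Split (W : Finset V) : Prop :=
  ∃ W₁ W₂ : Finset V, W₁.Nonempty ∧ W₂.Nonempty ∧ W₁.card < W.card ∧ W₂.card < W.card ∧
    W.card ≤ W₁.card + W₂.card + 1 ∧ df G W₁ + df G W₂ ≤ df G W + 2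

theorem split_of {W K : Finset V} (hKW : K ⊆ W) (hK : K.Nonempty) {p r : V} (hp : p ∈ W)
    (hpK : p ∉ K) (hr : r ∈ W) (hrK : r ∉ K) (hrp : r ≠ p)
    (hN : ∀ v ∈ K, ∀ u ∈ W, G.Adj v u → u ∈ K ∨ u = p) : Split G W := by
  classical
  set R := (W \ K).erase p with hR
  have hRW : R ⊆ W := (Finset.erase_subset _ _).trans Finset.sdiff_subset
  have h1 := (reduce (G := G) (W := W) (T := K) (A := {p}) hKW (by simpa using hpK)
    (by simpa using hN)).1
  have h2 := (reduce (G := G) (W := W) (T := R) (A := {p}) hRW (by simp [hR]) (by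
    intro v hv u hu huv
    by_cases hup : u = p
    · right; simpa using hup
    · left
      simp only [hR, Finset.mem_erase, Finset.mem_sdiff] at hv ⊢
      refine ⟨hup, hu, fun huK => ?_⟩
      rcases hN u huK v hv.2.1 huv.symm with h | h
      · exact hv.2.2 h
      · exact hv.1 h)).1
  have hdisj : Disjoint K R := by
    rw [Finset.disjoint_left]
    intro x hx hx'
    simp only [hR, Finset.mem_erase, Finset.mem_sdiff] at hx'
    exact hx'.2.2 hx
  have hWe : W = insert p (K ∪ R) := by
    ext x
    simp only [hR, Finset.mem_insert, Finset.mem_union, Finset.mem_erase, Finset.mem_sdiff]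
    constructor
    · intro hx; tauto
    · rintro (rfl | h | h)
      · exact hp
      · exact hKW h
      · exact h.2.1
  have hpn : p ∉ K ∪ R := by simp [hR, hpK]
  have hcard : W.card = K.card + R.card + 1 := by
    conv_lhs => rw [hWe]
    rw [Finset.card_insert_of_notMem hpn, Finset.card_union_of_disjoint hdisj]
  have hdf : ∑ v ∈ K, (3 - dg G W v) + ∑ v ∈ R, (3 - dg G W v) ≤ df G W := by
    rw [← Finset.sum_union hdisj, df]
    refine Finset.sum_le_sum_of_subset ?_
    exact Finset.union_subset hKW hRW
  have hKr : K ⊆ red G K {p} := subset_red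
  have hRr : R ⊆ red G R {p} := subset_red
  have hRne : R.Nonempty := ⟨r, by simp [hR, hr, hrK, hrp]⟩
  have hc1 : (red G K {p}).card ≤ K.card + 1 := by
    refine (Finset.card_union_le _ _).trans ?_
    have := Finset.card_filter_le ({p} : Finset V) (fun a => 2 ≤ dg G K a)
    simp only [Finset.card_singleton] at this
    omega
  have hc2 : (red G R {p}).card ≤ R.card + 1 := by
    refine (Finset.card_union_le _ _).trans ?_
    have := Finset.card_filter_le ({p} : Finset V) (fun a => 2 ≤ dg G R a)
    simp only [Finset.card_singleton] at this
    omega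
  have := hK.card_pos
  have := hRne.card_pos
  have := Finset.card_le_card hKr
  have := Finset.card_le_card hRr
  simp only [Finset.card_singleton] at h1 h2
  exact ⟨_, _, hK.mono hKr, hRne.mono hRr, by omega, by omega, by omega, by omega⟩

/-- Removing a vertex of degree at most one. -/
theorem df_leaf {W : Finset V} [DecidableEq V] {v : V} (hv : v ∈ W) (h : dg G W v ≤ 1) :
    df G (W.erase v) < df G W := by
  classical
  have h1 := (reduce (G := G) (W := W) (T := W.erase v) (A := {v}) (Finset.erase_subset _ _)
    (by simp) (by
      intro x hx u hu _
      by_cases huv : u = v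
      · right; simpa using huv
      · left; simp [huv, hu])).1
  have hr : red G (W.erase v) {v} = W.erase v := by
    ext x
    rw [mem_red]
    constructor
    · rintro (h2 | ⟨h2, h3⟩)
      · exact h2
      · simp only [Finset.mem_singleton] at h2
        subst h2
        have := dg_mono (G := G) (Finset.erase_subset x W) x
        omega
    · exact Or.inl
  rw [hr] at h1
  have h2 : df G W = (3 - dg G W v) + ∑ x ∈ W.erase v, (3 - dg G W x) := by
    exact (Finset.add_sum_erase W (fun x => 3 - dg G W x) hv).symm
  simp only [Finset.card_singleton] at h1
  omega

end degrees

section structural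
variable {V : Type*} {G : SimpleGraph V}

theorem Rch.restrict {T D : Set V} {w v : V} (h : Rch G T w v) (hw : w ∉ D)
    (hD : ∀ x ∈ T, x ∉ D → ∀ y ∈ T, G.Adj x y → y ∉ D) : Rch G (T \ D) w v := by
  have := h.closed (D := {x | Rch G (T \ D) w x}) (Rch.refl ⟨h.left, hw⟩) (by
    intro x hx y hy hxy
    have hx' : Rch G (T \ D) w x := hx
    exact hx'.snoc hxy ⟨hy, hD x hx'.right.1 hx'.right.2 y hy hxy⟩)
  exact this

theorem IsCyc.arcs {m : ℕ} {c : ℤ → V} (hc : IsCyc G m c) {i : ℤ} {d k k' : ℕ}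
    (hdm : d < m) (hk : k ≤ d) (hk' : k' ≤ m - d) {x : V} (h1 : x = c (i + k))
    (h2 : x = c (i + d + k')) : x = c i ∨ x = c (i + d) := by
  have h := (hc.inj (i + k) (i + d + k')).1 (h1.symm.trans h2)
  have e : i + d + k' - (i + k) = d + k' - k := by ring
  rw [e] at h
  rcases Nat.eq_zero_or_pos k with h0 | h0
  · subst h0
    left
    simpa using h1
  · have := small_dvd h (by omega) (by omega)
    right
    rw [h2]
    have : k' = 0 := by omega
    simp [this]

theorem IsCyc.ear_mem {m : ℕ} {c : ℤ → V} (hc : IsCyc G m c) {U : Set V} (hU : ∀ k, c k ∈ U)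
    {x : V} (hx : ∀ m' z, IsCyc G m' z → (∀ k, z k ∈ U) → ∃ k, z k = x) {i : ℤ} {d : ℕ}
    (hd : 0 < d) (hdm : d < m) {T : Set V} (hTU : T ⊆ U) (hT : ∀ y ∈ T, ∀ k, y ≠ c k)
    {v w : V} (hvw : Rch G T v w) (h1 : G.Adj v (c i)) (h2 : G.Adj w (c (i + d))) :
    x = c i ∨ x = c (i + d) := by
  obtain ⟨p, hp, hpT⟩ := hvw.exists_path
  obtain ⟨z, hz, -, hz1⟩ := hc.ear i d hd hdm p.reverse hp.reverse
    (fun x hx => hT x (hpT x (by simpa using hx))) h2.symm h1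
  have e : i + d + ((m - d : ℕ) : ℤ) = i + m := by push_cast [show d ≤ m by omega]; ring
  obtain ⟨z', hz', -, hz1'⟩ := hc.ear (i + d) (m - d) (by omega) (by omega) p hp
    (fun x hx => hT x (hpT x hx)) (by rw [e, hc.period]; exact h1.symm) h2
  obtain ⟨k0, hk0⟩ := hx m c hc hU
  obtain ⟨k1, hk1⟩ := hx _ z hz (fun k => by
    rcases hz1 k with h | ⟨j, -, h⟩
    · exact hTU (hpT _ (by simpa using h))
    · rw [h]; exact hU _)
  obtain ⟨k2, hk2⟩ := hx _ z' hz' (fun k => by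
    rcases hz1' k with h | ⟨j, -, h⟩
    · exact hTU (hpT _ h)
    · rw [h]; exact hU _)
  rcases hz1 k1 with h | ⟨j, hj, h⟩
  · exact absurd (hk1.trans hk0.symm) (hT _ (hpT _ (by simpa using h)) k0)
  · rcases hz1' k2 with h' | ⟨j', hj', h'⟩
    · exact absurd (hk2.trans hk0.symm) (hT _ (hpT _ h') k0)
    · exact hc.arcs hdm hj hj' (hk1.symm.trans h) (hk2.symm.trans h')

theorem IsCyc.chord_mem {m : ℕ} {c : ℤ → V} (hc : IsCyc G m c) {U : Set V} (hU : ∀ k, c k ∈ U)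
    {x : V} (hx : ∀ m' z, IsCyc G m' z → (∀ k, z k ∈ U) → ∃ k, z k = x) {i : ℤ} {d : ℕ}
    (hd : 2 ≤ d) (hdm : d + 2 ≤ m) (h1 : G.Adj (c i) (c (i + d))) :
    x = c i ∨ x = c (i + d) := by
  obtain ⟨z, hz, hz1⟩ := hc.chord i d hd (by omega) h1.symm
  have e : i + d + ((m - d : ℕ) : ℤ) = i + m := by push_cast [show d ≤ m by omega]; ring
  obtain ⟨z', hz', hz1'⟩ := hc.chord (i + d) (m - d) (by omega) (by omega)
    (by rw [e, hc.period]; exact h1)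
  obtain ⟨k1, hk1⟩ := hx _ z hz (fun k => by
    obtain ⟨j, -, h⟩ := hz1 k
    rw [h]; exact hU _)
  obtain ⟨k2, hk2⟩ := hx _ z' hz' (fun k => by
    obtain ⟨j, -, h⟩ := hz1' k
    rw [h]; exact hU _)
  obtain ⟨j, hj, h⟩ := hz1 k1
  obtain ⟨j', hj', h'⟩ := hz1' k2
  exact hc.arcs (by omega) hj hj' (hk1.symm.trans h) (hk2.symm.trans h')

theorem IsCyc.nbr {m : ℕ} {c : ℤ → V} (hc : IsCyc G m c) {i k : ℤ} (h : G.Adj (c i) (c k)) :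
    c k = c (i + 1) ∨ c k = c (i - 1) ∨ ∃ d : ℕ, 2 ≤ d ∧ d + 2 ≤ m ∧ c k = c (i + d) := by
  obtain ⟨d, hd, hk, -⟩ := hc.exists_window i k
  rcases Nat.lt_or_ge d 2 with h2 | h2
  · interval_cases d
    · simp only [Nat.cast_zero, add_zero] at hk
      rw [hk] at h
      exact absurd h (G.loopless.irrefl _)
    · left; simpa using hk
  · by_cases h3 : d + 2 ≤ m
    · exact Or.inr (Or.inr ⟨d, h2, h3, hk⟩)
    · right; left
      rw [hk, ← hc.period (i - 1)]
      congr 1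
      omega

theorem dg_le_two {W : Finset V} {v a b : V} (h : ∀ u ∈ W, G.Adj v u → u = a ∨ u = b) :
    dg G W v ≤ 2 := by
  classical
  refine (Finset.card_le_card (t := {a, b}) ?_).trans Finset.card_le_two
  intro u hu
  simp only [Finset.mem_filter] at hu
  simpa using h u hu.1 hu.2

theorem struct {W : Finset V} (hW : W.Nonempty) (hdeg : ∀ v ∈ W, 2 ≤ dg G W v) :
    (W.card ≤ df G W ∧ 3 ≤ df G W) ∨ Split G W ∨
    ∃ m c, IsCyc G m c ∧ (∀ i, c i ∈ W) ∧ (∃ w ∈ W, ∀ k, w ≠ c k) ∧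
      ∃ A : ℤ → Prop, (∀ w ∈ W, (∀ k, w ≠ c k) → ∀ i, A i ↔
        ∃ v, Rch G {x | x ∈ W ∧ ∀ k, x ≠ c k} w v ∧ G.Adj v (c i)) ∧
      ∀ i, ¬ A i → dg G W (c i) ≤ 2 := by
  classical
  by_cases hall : ∀ m c, IsCyc G m c → (∀ i, c i ∈ W) → ∀ v ∈ W, ∃ k, c k = v
  · left
    obtain ⟨m, c, hc, hcW⟩ := exists_cyc hW hdeg
    have hm := hc.three
    have h1 : ∀ v ∈ W, 1 ≤ 3 - dg G W v := by
      intro v hv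
      obtain ⟨i, rfl⟩ := hall m c hc hcW v hv
      have : dg G W (c i) ≤ 2 := by
        refine dg_le_two (a := c (i + 1)) (b := c (i - 1)) fun u hu hiu => ?_
        obtain ⟨k, rfl⟩ := hall m c hc hcW u hu
        rcases hc.nbr hiu with h | h | ⟨d, h2, h3, h4⟩
        · exact Or.inl h
        · exact Or.inr h
        · exfalso
          rw [h4] at hiu
          rcases hc.chord_mem (U := (W : Set V)) (x := c (i + 1)) hcW
            (fun m' z hz hzW => hall m' z hz hzW _ (hcW _)) h2 h3 hiu with h | h
          · have := hc.inj_window h (by omega) (by omega)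
            omega
          · have := hc.inj_window h (by omega) (by omega)
            omega
      omega
    have h2 : W.card ≤ df G W := by
      rw [df, Finset.card_eq_sum_ones]
      exact Finset.sum_le_sum h1
    have h3 : cs m c ⊆ W := by
      intro x hx
      obtain ⟨k, rfl⟩ := (mem_cs hc).1 hx
      exact hcW k
    have h4 := Finset.card_le_card h3
    rw [card_cs hc] at h4
    exact ⟨h2, by omega⟩
  right
  by_cases hsp : Split G W
  · exact Or.inl hsp
  right
  push Not at hall
  obtain ⟨m0, c0, hc0, hc0W, v0, hv0, hv0c⟩ := hall
  let P : Finset V → Prop := fun D => D.Nonempty ∧ (∀ u ∈ D, ∀ v ∈ D, Rch G (D : Set V) u v) ∧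
    ∃ m c, IsCyc G m c ∧ ∀ i, c i ∈ W ∧ c i ∉ D
  obtain ⟨D, hD, hmax⟩ := Finset.exists_max_image (W.powerset.filter P) Finset.card (by
    refine ⟨{v0}, ?_⟩
    simp only [Finset.mem_filter, Finset.mem_powerset, Finset.singleton_subset_iff]
    refine ⟨hv0, ⟨v0, by simp⟩, ?_, m0, c0, hc0, fun i => ⟨hc0W i, by simpa using hv0c i⟩⟩
    intro u hu v hv
    simp only [Finset.mem_singleton] at hu hv
    subst hu; subst hv
    exact Rch.refl (by simp))
  simp only [Finset.mem_filter, Finset.mem_powerset] at hD hmax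
  obtain ⟨hDW, ⟨d0, hd0⟩, hDc, m, c, hc, hcD⟩ := hD
  have hmem : ∀ a ∈ W, a ∉ D → (∃ d ∈ D, G.Adj d a) → ∀ m z, IsCyc G m z →
      (∀ k, z k ∈ {x | x ∈ W ∧ x ∉ D}) → ∃ k, z k = a := by
    rintro a ha haD ⟨d, hd, hda⟩ m z hz hzD
    by_contra hno
    push Not at hno
    have hsub : (D : Set V) ⊆ ((insert a D : Finset V) : Set V) := by simp
    have haI : a ∈ ((insert a D : Finset V) : Set V) := by simp
    have hra : ∀ u ∈ D, Rch G ((insert a D : Finset V) : Set V) u a := fun u hu =>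
      ((hDc u hu d hd).mono hsub).snoc hda haI
    have := hmax (insert a D) ⟨Finset.insert_subset ha hDW, ⟨a, by simp⟩, ?_, m, z, hz, ?_⟩
    · rw [Finset.card_insert_of_notMem haD] at this
      omega
    · intro u hu v hv
      rcases Finset.mem_insert.1 hu with rfl | hu2
      · rcases Finset.mem_insert.1 hv with rfl | hv
        · exact Rch.refl haI
        · exact (hra v hv).symm
      · rcases Finset.mem_insert.1 hv with rfl | hv
        · exact hra u hu2
        · exact (hDc u hu2 v hv).mono hsub
    · intro i
      refine ⟨(hzD i).1, ?_⟩
      rw [Finset.mem_insert]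
      rintro (h | h)
      · exact hno i h
      · exact (hzD i).2 h
  have hcW : ∀ i, c i ∈ W := fun i => (hcD i).1
  have hDout : ∀ d ∈ D, ∀ k, d ≠ c k := by
    rintro d hd k rfl
    exact (hcD k).2 hd
  set Out : Set V := {x | x ∈ W ∧ ∀ k, x ≠ c k} with hOut
  have hDO : (D : Set V) ⊆ Out := fun d hd => ⟨hDW hd, hDout d hd⟩
  have hclD : ∀ x ∈ D, ∀ y ∈ Out, G.Adj x y → y ∈ D := by
    intro x hx y hy hxy
    by_contra hyD
    obtain ⟨k, hk⟩ := hmem y hy.1 hyD ⟨x, hx, hxy⟩ m c hc hcD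
    exact hy.2 k hk.symm
  -- every outside vertex attaches twice
  have htwo : ∀ w ∈ Out, ∃ i j, c i ≠ c j ∧ (∃ v, Rch G Out w v ∧ G.Adj v (c i)) ∧
      ∃ v, Rch G Out w v ∧ G.Adj v (c j) := by
    intro w hw
    by_contra hno
    push Not at hno
    have : ∃ i, ∀ j, (∃ v, Rch G Out w v ∧ G.Adj v (c j)) → c j = c i := by
      by_cases hex : ∃ i, ∃ v, Rch G Out w v ∧ G.Adj v (c i)
      · obtain ⟨i, v, hv, hvi⟩ := hex
        refine ⟨i, ?_⟩
        rintro j ⟨u, hu, huj⟩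
        by_contra hne
        exact hno j i hne ⟨u, hu, huj⟩ v hv hvi
      · exact ⟨0, fun j hj => absurd ⟨j, hj⟩ hex⟩
    obtain ⟨i, hi⟩ := this
    refine hsp (split_of (K := W.filter (fun v => Rch G Out w v)) (p := c i) (r := c (i + 1))
      (Finset.filter_subset _ _) ⟨w, by simp [hw.1, Rch.refl hw]⟩ (hcW _) ?_ (hcW _) ?_
      (G.ne_of_adj (hc.adj i)).symm ?_)
    · intro h
      exact (Finset.mem_filter.1 h).2.right.2 i rfl
    · intro h
      exact (Finset.mem_filter.1 h).2.right.2 (i + 1) rfl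
    · intro v hv u hu hvu
      have hv' := (Finset.mem_filter.1 hv).2
      by_cases huc : ∀ k, u ≠ c k
      · left
        exact Finset.mem_filter.2 ⟨hu, hv'.snoc hvu ⟨hu, huc⟩⟩
      · push Not at huc
        obtain ⟨k, rfl⟩ := huc
        exact Or.inr (hi k ⟨v, hv', hvu⟩)
  have hattD : ∀ w ∈ D, ∀ i, (∃ d ∈ D, G.Adj d (c i)) ↔
      ∃ v, Rch G Out w v ∧ G.Adj v (c i) := by
    intro w hw i
    constructor
    · rintro ⟨d, hd, hdi⟩
      exact ⟨d, (hDc w hw d hd).mono hDO, hdi⟩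
    · rintro ⟨v, hv, hvi⟩
      exact ⟨v, hv.closed (D := (D : Set V)) hw hclD, hvi⟩
  obtain ⟨i0, j0, hij0, hi0, hj0⟩ := htwo d0 (hDO hd0)
  rw [← hattD d0 hd0] at hi0 hj0
  have hU : ∀ k, c k ∈ {x | x ∈ W ∧ x ∉ D} := hcD
  have hA : ∀ k, (∃ d ∈ D, G.Adj d (c k)) → ∀ m z, IsCyc G m z →
      (∀ i, z i ∈ {x | x ∈ W ∧ x ∉ D}) → ∃ i, z i = c k :=
    fun k hk => hmem (c k) (hcW k) (hcD k).2 hk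
  have hear : ∀ w ∈ Out, w ∉ D → ∀ i j, c i ≠ c j → (∃ v, Rch G Out w v ∧ G.Adj v (c i)) →
      (∃ v, Rch G Out w v ∧ G.Adj v (c j)) → ∀ k, (∃ d ∈ D, G.Adj d (c k)) →
      c k = c i ∨ c k = c j := by
    rintro w hw hwD i j hij ⟨v, hv, hvi⟩ ⟨u, hu, huj⟩ k hk
    have hstep : ∀ x ∈ Out, x ∉ (D : Set V) → ∀ y ∈ Out, G.Adj x y → y ∉ (D : Set V) :=
      fun x hx hxD y _ hxy hyD => hxD (hclD y hyD x hx hxy.symm)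
    have hv' := hv.restrict hwD hstep
    have hu' := hu.restrict hwD hstep
    obtain ⟨d, hd, hjd, -⟩ := hc.exists_window i j
    have hd0 : 0 < d := by
      rcases Nat.eq_zero_or_pos d with h | h
      · subst h
        simp only [Nat.cast_zero, add_zero] at hjd
        exact absurd hjd.symm hij
      · exact h
    rw [hjd] at huj ⊢
    exact hc.ear_mem hU (hA k hk) hd0 hd (T := Out \ D) (fun x hx => ⟨hx.1.1, hx.2⟩)
      (fun x hx => hx.1.2) (hv'.symm.trans hu') hvi huj
  have heq : ∀ w ∈ Out, ∀ i, (∃ d ∈ D, G.Adj d (c i)) ↔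
      ∃ v, Rch G Out w v ∧ G.Adj v (c i) := by
    intro w hw i
    by_cases hwD : w ∈ D
    · exact hattD w hwD i
    obtain ⟨i1, j1, hij1, hi1, hj1⟩ := htwo w hw
    constructor
    · intro hi
      rcases hear w hw hwD i1 j1 hij1 hi1 hj1 i hi with h | h
      · rw [h]; exact hi1
      · rw [h]; exact hj1
    · intro hi
      by_contra hno
      have : ∃ i2, c i ≠ c i2 ∧ ∃ v, Rch G Out w v ∧ G.Adj v (c i2) := by
        by_cases h : c i = c i1
        · exact ⟨j1, h ▸ hij1, hj1⟩
        · exact ⟨i1, h, hi1⟩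
      obtain ⟨i2, hii2, hi2⟩ := this
      have h1 := hear w hw hwD i i2 hii2 hi hi2 i0 hi0
      have h2 := hear w hw hwD i i2 hii2 hi hi2 j0 hj0
      have h3 : c i0 ≠ c i := fun h => hno (h ▸ hi0)
      have h4 : c j0 ≠ c i := fun h => hno (h ▸ hj0)
      exact hij0 ((h1.resolve_left h3).trans (h2.resolve_left h4).symm)
  refine ⟨m, c, hc, hcW, ⟨d0, hDW hd0, hDout d0 hd0⟩, fun i => ∃ d ∈ D, G.Adj d (c i),
    fun w hw hwc i => heq w ⟨hw, hwc⟩ i, fun i hi => ?_⟩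
  refine dg_le_two (a := c (i + 1)) (b := c (i - 1)) fun u hu hiu => ?_
  by_cases huc : ∀ k, u ≠ c k
  · exact absurd ((heq u ⟨hu, huc⟩ i).2 ⟨u, Rch.refl ⟨hu, huc⟩, hiu.symm⟩) hi
  push Not at huc
  obtain ⟨k, rfl⟩ := huc
  rcases hc.nbr hiu with h | h | ⟨d, h2, h3, h4⟩
  · exact Or.inl h
  · exact Or.inr h
  · exfalso
    rw [h4] at hiu
    have h1 := hc.chord_mem hU (hA i0 hi0) h2 h3 hiu
    have h2 := hc.chord_mem hU (hA j0 hj0) h2 h3 hiu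
    have h3 : c i0 ≠ c i := fun h => by rw [h] at hi0; exact hi hi0
    have h4 : c j0 ≠ c i := fun h => by rw [h] at hj0; exact hi hj0
    exact hij0 ((h1.resolve_left h3).trans (h2.resolve_left h4).symm)

end structural

section counting
variable {V : Type*} {G : SimpleGraph V}

theorem count {m : ℕ} {c : ℤ → V} (hc : IsCyc G m c) {A : ℤ → Prop}
    (hcongr : ∀ i j, c i = c j → A i → A j)
    (hno : ∀ i, A i → ¬ A (i + ((m - 1) / 2 : ℕ))) :
    ∃ As Bs : Finset V, (∀ x, x ∈ As ↔ ∃ i, x = c i ∧ A i) ∧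
      (∀ x, x ∈ Bs ↔ ∃ i, x = c i ∧ ¬ A i) ∧ As.card + Bs.card = m ∧ As.card ≤ Bs.card ∧
      (As.card = Bs.card → m = 2 * ((m - 1) / 2) + 2 ∧
        (∀ i, ¬ A i → A (i - ((m - 1) / 2 : ℕ))) ∧ ∀ i, A (i + 1) ↔ ¬ A i) := by
  classical
  have hm := hc.three
  set d : ℕ := (m - 1) / 2 with hd
  set As := (cs m c).filter (fun x => ∃ i, x = c i ∧ A i) with hAs
  set Bs := (cs m c).filter (fun x => ¬ ∃ i, x = c i ∧ A i) with hBs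
  have hA : ∀ x, x ∈ As ↔ ∃ i, x = c i ∧ A i := by
    intro x
    simp only [hAs, Finset.mem_filter, mem_cs hc]
    constructor
    · exact fun h => h.2
    · rintro ⟨i, hi, hi'⟩
      exact ⟨⟨i, hi⟩, i, hi, hi'⟩
  have hB : ∀ x, x ∈ Bs ↔ ∃ i, x = c i ∧ ¬ A i := by
    intro x
    simp only [hBs, Finset.mem_filter, mem_cs hc]
    constructor
    · rintro ⟨⟨i, hi⟩, h⟩
      exact ⟨i, hi, fun h' => h ⟨i, hi, h'⟩⟩
    · rintro ⟨i, hi, hi'⟩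
      refine ⟨⟨i, hi⟩, ?_⟩
      rintro ⟨j, hj, hj'⟩
      exact hi' (hcongr j i (hj.symm.trans hi) hj')
  have hcard : As.card + Bs.card = m := by
    rw [← card_cs hc]
    exact Finset.card_filter_add_card_filter_not _
  have hidx : ∀ x, ∃ i, x ∈ As → x = c i ∧ A i := by
    intro x
    by_cases hx : x ∈ As
    · obtain ⟨i, hi⟩ := (hA x).1 hx
      exact ⟨i, fun _ => hi⟩
    · exact ⟨0, fun h => absurd h hx⟩
  choose idx hidx using hidx
  have hmaps : Set.MapsTo (fun x => c (idx x + d)) (As : Set V) (Bs : Set V) := by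
    intro x hx
    exact (hB _).2 ⟨_, rfl, hno _ (hidx x hx).2⟩
  have hinj : Set.InjOn (fun x => c (idx x + d)) (As : Set V) := by
    intro x hx y hy hxy
    rw [(hidx x hx).1, (hidx y hy).1, hc.inj]
    have := (hc.inj _ _).1 hxy
    convert this using 1
    ring
  refine ⟨As, Bs, hA, hB, hcard, Finset.card_le_card_of_injOn _ hmaps hinj, fun heq => ?_⟩
  have hmd : m = 2 * d + 2 := by omega
  have hcomp : ∀ i, ¬ A i → A (i - d) := by
    intro i hi
    have hs := Finset.surjOn_of_injOn_of_card_le _ hmaps hinj heq.ge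
    obtain ⟨x, hx, hxi⟩ := hs (show c i ∈ (Bs : Set V) from (hB _).2 ⟨i, rfl, hi⟩)
    refine hcongr (idx x) (i - d) ?_ (hidx x hx).2
    rw [hc.inj]
    have := (hc.inj _ _).1 hxi
    convert this using 1
    ring
  have hcomp' : ∀ i, ¬ A (i + d) → A i := by
    intro i hi
    have := hcomp _ hi
    rwa [add_sub_cancel_right] at this
  have hper : ∀ i, A (i + m) → A i := fun i => hcongr _ _ (hc.period i)
  have hper' : ∀ i, A i → A (i + m) := fun i => hcongr _ _ (hc.period i).symm
  have h2 : ∀ i, A (i + 2) → A i := by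
    intro i hi
    apply hcomp'
    intro h
    have h3 := hno _ h
    have e : i + 2 + m - 2 = i + d + d + 2 := by rw [hmd]; push_cast; ring
    refine hno (i + 2) hi (hcomp' _ fun h4 => ?_)
    have e2 : i + 2 + d + d = i + m := by rw [hmd]; push_cast; ring
    rw [e2] at h4
    exact hno i (hper i h4) h
  have h2' : ∀ i, A i → A (i + 2) := by
    intro i hi
    apply hcomp'
    intro h
    have e2 : i + 2 + d + d = i + m := by rw [hmd]; push_cast; ring
    have := hno _ h
    rw [e2] at this
    exact this (hper' i hi)
  have hall : ∀ i, A i → A (i + 1) → ∀ k : ℕ, A (i + k) ∧ A (i + k + 1) := by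
    intro i h h' k
    induction k with
    | zero => simpa using ⟨h, h'⟩
    | succ k ih =>
      refine ⟨by push_cast; rw [← add_assoc]; exact ih.2, ?_⟩
      have := h2' _ ih.1
      convert this using 1
      push_cast; ring
  have hall' : ∀ i, ¬ A i → ¬ A (i + 1) → ∀ k : ℕ, ¬ A (i + k) ∧ ¬ A (i + k + 1) := by
    intro i h h' k
    induction k with
    | zero => simpa using ⟨h, h'⟩
    | succ k ih =>
      refine ⟨by push_cast; rw [← add_assoc]; exact ih.2, fun h3 => ih.1 (h2 _ ?_)⟩
      convert h3 using 1
      push_cast; ring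
  refine ⟨hmd, hcomp, fun i => ⟨fun h h' => ?_, fun h => ?_⟩⟩
  · exact hno i h' (hall i h' h d).1
  · by_contra h'
    exact h (hcomp' i (hall' i h h' d).1)

theorem three_le_dg {W : Finset V} {m : ℕ} {c : ℤ → V} (hc : IsCyc G m c) (hcW : ∀ i, c i ∈ W)
    {v : V} (hv : v ∈ W) (hvc : ∀ k, v ≠ c k) {i : ℤ} (h : G.Adj v (c i)) :
    3 ≤ dg G W (c i) := by
  classical
  have hm := hc.three
  have hne : c (i + 1) ≠ c (i - 1) := by
    intro h
    have := hc.inj_window h (by omega) (by omega)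
    omega
  have : ({v, c (i + 1), c (i - 1)} : Finset V).card = 3 := by
    rw [Finset.card_eq_three]
    exact ⟨_, _, _, hvc _, hvc _, hne, rfl⟩
  rw [← this]
  refine Finset.card_le_card ?_
  intro u hu
  simp only [Finset.mem_insert, Finset.mem_singleton] at hu
  simp only [Finset.mem_filter]
  rcases hu with rfl | rfl | rfl
  · exact ⟨hv, h.symm⟩
  · exact ⟨hcW _, hc.adj i⟩
  · refine ⟨hcW _, ?_⟩
    have := hc.adj (i - 1)
    rw [sub_add_cancel] at this
    exact this.symm

/-- A short path outside `W` joining two vertices. -/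
def Link (G : SimpleGraph V) (W : Finset V) (v v' : V) : Prop :=
  ∃ (y' y : V) (q : G.Walk y' y), q.IsPath ∧ q.length ≤ 2 ∧ (∀ x ∈ q.support, x ∉ W) ∧
    G.Adj v' y' ∧ G.Adj y v

theorem link_false (hG : NoGP G) {W : Finset V} {m : ℕ} {c : ℤ → V} (hc : IsCyc G m c)
    (hcW : ∀ i, c i ∈ W) {w : V} (hw : w ∈ W) (hwc : ∀ k, w ≠ c k) {A : ℤ → Prop}
    (hA : ∀ w ∈ W, (∀ k, w ≠ c k) → ∀ i, A i ↔
        ∃ v, Rch G {x | x ∈ W ∧ ∀ k, x ≠ c k} w v ∧ G.Adj v (c i))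
    (hmd : m = 2 * ((m - 1) / 2) + 2) (hcomp : ∀ i, ¬ A i → A (i - ((m - 1) / 2 : ℕ)))
    (halt : ∀ i, A (i + 1) ↔ ¬ A i) {i0 : ℤ} (hi0 : ¬ A i0) {v' : V} (hv' : v' ∈ W)
    (hvv' : v' ≠ c i0) (hdg : dg G W v' ≤ 2) (hL : Link G W (c i0) v') : False := by
  have hm := hc.three
  obtain ⟨y', y, q, hq, hql, hqW, hy', hy⟩ := hL
  have hqc : ∀ x ∈ q.support, ∀ k, x ≠ c k := by
    rintro x hx k rfl
    exact hqW _ hx (hcW k)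
  by_cases hvc : ∀ k, v' ≠ c k
  · obtain ⟨u, hu, hui⟩ := (hA v' hv' hvc _).1 (hcomp i0 hi0)
    have hR : Rch G {x | ∀ k, x ≠ c k} v' y := by
      refine (Rch.of_adj hy' ?_ ?_).trans ⟨q, hqc⟩
      · exact hvc
      · exact hqc _ q.start_mem_support
    refine hG.no_link hc (T := {x | ∀ k, x ≠ c k}) (fun x hx => hx) _
      ((hu.mono (fun x hx => hx.2)).symm.trans hR) hui ?_
    rw [sub_add_cancel]
    exact hy
  push Not at hvc
  obtain ⟨j, rfl⟩ := hvc
  obtain ⟨e, he, hje, -⟩ := hc.exists_window i0 j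
  rw [hje] at hvv' hdg hy'
  have hne : ¬ A (i0 + e) := by
    intro h
    obtain ⟨v, hv, hvi⟩ := (hA w hw hwc _).1 h
    have := three_le_dg hc hcW hv.right.1 hv.right.2 hvi
    omega
  have hpar : ∀ k : ℕ, A (i0 + k) ↔ k % 2 = 1 := by
    intro k
    induction k with
    | zero => simpa using hi0
    | succ k ih =>
      have := halt (i0 + k)
      rw [ih] at this
      push_cast
      rw [← add_assoc, this]
      omega
  obtain ⟨α, hα⟩ : ∃ α, e = 2 * α := ⟨e / 2, by have := (hpar e).not.1 hne; omega⟩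
  have hα0 : 0 < α := by
    rcases Nat.eq_zero_or_pos α with h | h
    · subst h
      simp [hα] at hvv'
    · exact h
  obtain ⟨z, hz, hz1, hz2⟩ := hc.ear i0 e (by omega) he q hq hqc hy' hy
  set T : Set V := {x | ∀ k, x ≠ z k} with hT
  have hOT : {x | x ∈ W ∧ ∀ k, x ≠ c k} ⊆ T := by
    rintro x ⟨hxW, hxc⟩ k rfl
    rcases hz2 k with h | ⟨r, -, h⟩
    · exact hqW _ h hxW
    · exact hxc _ h
  have hcT : ∀ j : ℤ, (∀ r : ℕ, r ≤ e → c j ≠ c (i0 + r)) → c j ∈ T := by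
    intro j hj k hk
    rcases hz2 k with h | ⟨r, hr, h⟩
    · rw [← hk] at h
      exact hqW _ h (hcW j)
    · exact hj r hr (hk.trans h)
  have hatt : ∀ k : ℕ, (k = 0 ∨ k = e ∨ (k % 2 = 1 ∧ k < e)) →
      ∃ v, Rch G T w v ∧ G.Adj v (z k) := by
    intro k hk
    rw [hz1 k (by omega)]
    rcases hk with rfl | rfl | ⟨hk, hk'⟩
    · have h1 : A (i0 - 1) := by
        by_contra h
        rw [← halt, sub_add_cancel] at h
        exact hi0 h
      obtain ⟨v, hv, hvi⟩ := (hA w hw hwc _).1 h1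
      refine ⟨c (i0 - 1), (hv.mono hOT).snoc hvi (hcT _ ?_), ?_⟩
      · intro r hr h
        have := hc.inj_window h (by omega) (by omega)
        omega
      · have := hc.adj (i0 - 1)
        simpa using this
    · have h1 : A (i0 + k + 1) := (halt _).2 hne
      obtain ⟨v, hv, hvi⟩ := (hA w hw hwc _).1 h1
      refine ⟨c (i0 + k + 1), (hv.mono hOT).snoc hvi (hcT _ ?_), ?_⟩
      · intro r hr h
        have := hc.inj_window h (by omega) (by omega)
        omega
      · exact (hc.adj _).symm
    · obtain ⟨v, hv, hvi⟩ := (hA w hw hwc _).1 ((hpar k).2 hk)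
      exact ⟨v, hv.mono hOT, hvi⟩
  have hfin : ∀ s t : ℕ, t = s + (e + q.length + 2 - 1) / 2 →
      (s = 0 ∨ s = e ∨ (s % 2 = 1 ∧ s < e)) → (t = 0 ∨ t = e ∨ (t % 2 = 1 ∧ t < e)) →
      False := by
    intro s t hst hs ht
    obtain ⟨v, hv, hvs⟩ := hatt s hs
    obtain ⟨u, hu, hut⟩ := hatt t ht
    refine hG.no_link hz (T := T) (fun x hx => hx) s (hv.symm.trans hu) hvs ?_
    rw [hst] at hut
    push_cast at hut ⊢
    exact hut
  rcases Nat.mod_two_eq_zero_or_one α with ha | ha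
  · by_cases hl : q.length = 0
    · exact hfin 1 (α + 1) (by omega) (by omega) (by omega)
    · exact hfin 0 (α + 1) (by omega) (by omega) (by omega)
  · by_cases hl : q.length = 0
    · exact hfin 0 α (by omega) (by omega) (by omega)
    · by_cases h1 : α = 1
      · exact hfin 0 2 (by omega) (by omega) (by omega)
      · exact hfin 1 (α + 2) (by omega) (by omega) (by omega)

end counting

section mainproof
variable {V : Type*} {G : SimpleGraph V}

theorem Link.mono {W W' : Finset V} (h : W' ⊆ W) {v v' : V} (hL : Link G W v v') :
    Link G W' v v' := by
  obtain ⟨y', y, q, hq, hl, hs, h1, h2⟩ := hL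
  exact ⟨y', y, q, hq, hl, fun x hx hx' => hs x hx (h hx'), h1, h2⟩

theorem mkLink {W : Finset V} {v v' u1 u2 x : V} (hx : x ∉ W) (hu : u1 ≠ u2)
    (h1 : G.Adj u1 x) (h2 : G.Adj x u2) (hv : v = u1 ∨ (u1 ∉ W ∧ G.Adj v u1))
    (hv' : v' = u2 ∨ (u2 ∉ W ∧ G.Adj v' u2)) : Link G W v v' := by
  have n1 := h1.ne
  have n2 := h2.ne
  rcases hv with rfl | ⟨hv, hv1⟩
  · rcases hv' with rfl | ⟨hv', hv1'⟩
    · exact ⟨x, x, .nil, by simp, by simp, by simpa using hx, h2.symm, h1.symm⟩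
    · refine ⟨u2, x, .cons h2.symm .nil, ?_, by simp, ?_, hv1', h1.symm⟩
      · simp [n2.symm]
      · simp [hx, hv']
  · rcases hv' with rfl | ⟨hv', hv1'⟩
    · refine ⟨x, u1, .cons h1.symm .nil, ?_, by simp, ?_, h2.symm, hv1.symm⟩
      · simp [n1.symm]
      · simp [hx, hv]
    · refine ⟨u2, u1, .cons h2.symm (.cons h1.symm .nil), ?_, by simp, ?_, hv1', hv1.symm⟩
      · simp [n1.symm, n2.symm, hu.symm]
      · simp [hv', hx, hv]

/-- The bound to be proved. -/
def Good (G : SimpleGraph V) (W : Finset V) : Prop :=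
  ∃ e, 1 ≤ e ∧ df G W = e + 2 ∧ W.card ≤ 5 * e ^ 2 + 8 * e

theorem good_small {W : Finset V} (h : 3 ≤ df G W) (h' : W.card ≤ 4 * df G W + 1) :
    Good G W := by
  obtain ⟨e, he⟩ : ∃ e, df G W = e + 2 := ⟨df G W - 2, by omega⟩
  refine ⟨e, by omega, he, ?_⟩
  have : 1 ≤ e := by omega
  nlinarith

theorem good_fin {W W' : Finset V} (hg : Good G W') (h : df G W' < df G W)
    (h' : W.card ≤ W'.card + 4 * df G W + 1) : Good G W := by
  obtain ⟨e', h1, h2, h3⟩ := hg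
  obtain ⟨s, hs⟩ : ∃ s, df G W = e' + 1 + s + 2 := ⟨df G W - e' - 3, by omega⟩
  refine ⟨e' + 1 + s, by omega, hs, ?_⟩
  rw [hs] at h'
  nlinarith

theorem good_split {W W₁ W₂ : Finset V} (hg₁ : Good G W₁) (hg₂ : Good G W₂)
    (h : df G W₁ + df G W₂ ≤ df G W + 2)
    (h' : W.card ≤ W₁.card + W₂.card + 1 + 2 * df G W) : Good G W := by
  obtain ⟨e₁, h1, h2, h3⟩ := hg₁
  obtain ⟨e₂, h4, h5, h6⟩ := hg₂
  obtain ⟨s, hs⟩ : ∃ s, df G W = e₁ + e₂ + s + 2 := ⟨df G W - e₁ - e₂ - 2, by omega⟩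
  refine ⟨e₁ + e₂ + s, by omega, hs, ?_⟩
  rw [hs] at h'
  have : (e₁ - 1 + 1) = e₁ := by omega
  obtain ⟨a, rfl⟩ : ∃ a, e₁ = a + 1 := ⟨e₁ - 1, by omega⟩
  obtain ⟨b, rfl⟩ : ∃ b, e₂ = b + 1 := ⟨e₂ - 1, by omega⟩
  nlinarith [Nat.zero_le (a * b), Nat.zero_le (a * s), Nat.zero_le (b * s)]

theorem df_singleton (a : V) : df G {a} = 3 := by
  classical
  simp [df, dg, Finset.filter_singleton]

/-- The invariant. -/
def Inv (G : SimpleGraph V) (W0 W : Finset V) : Prop := by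
  classical
  exact W ⊆ W0 ∧ W.Nonempty ∧ df G W ≤ df G W0 ∧
    (W0 \ W).card + 2 * (W.filter (fun v => dg G W0 v ≤ 2)).card ≤ 2 * df G W0 ∧
    ∀ v ∈ W, dg G W v ≤ 2 → 3 ≤ dg G W0 v →
      ∃ v' ∈ W, v' ≠ v ∧ dg G W v' ≤ 2 ∧ 3 ≤ dg G W0 v' ∧ Link G W v v'

open Classical in
theorem Inv.cyc (hG : NoGP G) {W0 W : Finset V} (hI : Inv G W0 W) (hdf : df G W = df G W0)
    (hdg2 : ∀ v ∈ W, 2 ≤ dg G W v)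
    {m : ℕ} {c : ℤ → V} (hc : IsCyc G m c) (hcW : ∀ i, c i ∈ W) {w : V} (hw : w ∈ W)
    (hwc : ∀ k, w ≠ c k) {A : ℤ → Prop}
    (hA : ∀ w ∈ W, (∀ k, w ≠ c k) → ∀ i, A i ↔
        ∃ v, Rch G {x | x ∈ W ∧ ∀ k, x ≠ c k} w v ∧ G.Adj v (c i))
    (hA2 : ∀ i, ¬ A i → dg G W (c i) ≤ 2) :
    ∃ W' : Finset V, W'.Nonempty ∧ W'.card < W.card ∧ df G W' ≤ df G W0 ∧
      W0.card ≤ W'.card + 4 * df G W0 ∧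
      (df G W' < df G W0 ∨ (∃ v ∈ W', dg G W' v ≤ 1) ∨ Inv G W0 W') := by
  have hm := hc.three
  obtain ⟨hWW0, hWne, -, hI2, hI3⟩ := hI
  have hcongr : ∀ i j, c i = c j → A i → A j := by
    intro i j hij hi
    rw [hA w hw hwc] at hi ⊢
    rwa [← hij]
  have hno : ∀ i, A i → ¬ A (i + ((m - 1) / 2 : ℕ)) := by
    intro i h1 h2
    obtain ⟨v, hv, hvi⟩ := (hA w hw hwc _).1 h1
    obtain ⟨u, hu, hui⟩ := (hA w hw hwc _).1 h2
    exact hG.no_link hc (fun x hx => hx.2) i (hv.symm.trans hu) hvi hui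
  obtain ⟨As, Bs, hAs, hBs, hcard, hle, heq⟩ := count hc hcongr hno
  set T := W \ cs m c with hTdef
  have hT : ∀ x, x ∈ T ↔ x ∈ W ∧ ∀ k, x ≠ c k := by
    intro x
    simp only [hTdef, Finset.mem_sdiff, mem_cs hc]
    push Not
    rfl
  have hcsW : cs m c ⊆ W := by
    intro x hx
    obtain ⟨k, rfl⟩ := (mem_cs hc).1 hx
    exact hcW k
  have hTW : T ⊆ W := Finset.sdiff_subset
  have hTA : Disjoint T As := by
    rw [Finset.disjoint_left]
    intro x hx hx'
    obtain ⟨i, hi, -⟩ := (hAs x).1 hx'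
    exact ((hT x).1 hx).2 i hi
  have hN : ∀ v ∈ T, ∀ u ∈ W, G.Adj v u → u ∈ T ∨ u ∈ As := by
    intro v hv u hu hvu
    have hv' := (hT v).1 hv
    by_cases huc : ∀ k, u ≠ c k
    · exact Or.inl ((hT u).2 ⟨hu, huc⟩)
    · push Not at huc
      obtain ⟨k, rfl⟩ := huc
      exact Or.inr ((hAs _).2 ⟨k, rfl, (hA v hv'.1 hv'.2 k).2 ⟨v, Rch.refl hv', hvu⟩⟩)
  obtain ⟨hr1, hr2⟩ := reduce hTW hTA hN
  set W' := red G T As with hW'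
  have hBcs : Bs ⊆ cs m c := by
    intro x hx
    obtain ⟨k, hk, -⟩ := (hBs x).1 hx
    exact (mem_cs hc).2 ⟨k, hk⟩
  have hsum : ∑ v ∈ T, (3 - dg G W v) + Bs.card ≤ df G W0 := by
    rw [← hdf, df, ← Finset.sum_sdiff hcsW]
    refine Nat.add_le_add_left ?_ _
    rw [Finset.card_eq_sum_ones]
    refine le_trans (Finset.sum_le_sum (g := fun v => 3 - dg G W v) ?_)
      (Finset.sum_le_sum_of_subset hBcs)
    intro x hx
    obtain ⟨k, rfl, hk⟩ := (hBs x).1 hx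
    have := hA2 k hk
    omega
  have hcW' : ∀ i, ¬ A i → c i ∉ W' := by
    intro i hi h
    rcases mem_red.1 h with h | ⟨h, -⟩
    · exact ((hT _).1 h).2 i rfl
    · obtain ⟨j, hj, hj'⟩ := (hAs _).1 h
      exact hi (hcongr j i hj.symm hj')
  have hTW' : T ⊆ W' := subset_red
  have hW'W : W' ⊆ W := by
    intro x hx
    rcases mem_red.1 hx with h | ⟨h, -⟩
    · exact hTW h
    · obtain ⟨j, rfl, -⟩ := (hAs _).1 h
      exact hcW j
  have hwT : w ∈ T := (hT w).2 ⟨hw, hwc⟩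
  have hsd : W \ W' ⊆ cs m c := by
    intro x hx
    simp only [Finset.mem_sdiff] at hx
    by_contra hxc
    exact hx.2 (hTW' (by simp [hTdef, hx.1, hxc]))
  have hsdc : (W \ W').card ≤ m := by
    rw [← card_cs hc]
    exact Finset.card_le_card hsd
  have hcWW' : (W \ W').card + W'.card = W.card := Finset.card_sdiff_add_card_eq_card hW'W
  have hcW0W : (W0 \ W).card + W.card = W0.card := Finset.card_sdiff_add_card_eq_card hWW0
  obtain ⟨b, hb⟩ : Bs.Nonempty := by
    rw [← Finset.card_pos]; omega
  obtain ⟨ib, rfl, hib⟩ := (hBs b).1 hb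
  have hlt : W'.card < W.card := by
    refine Finset.card_lt_card ⟨hW'W, fun h => hcW' ib hib (h (hcW ib))⟩
  refine ⟨W', ⟨w, hTW' hwT⟩, hlt, by omega, by omega, ?_⟩
  by_cases hlt' : df G W' < df G W0
  · exact Or.inl hlt'
  right
  have hab : As.card = Bs.card := by omega
  obtain ⟨hmd, hcomp, halt⟩ := heq hab
  obtain ⟨hrT, hrA⟩ := hr2 (by omega)
  by_cases hleaf : ∃ v ∈ W', dg G W' v ≤ 1
  · exact Or.inl hleaf
  right
  push Not at hleaf
  have hB : ∀ i, ¬ A i → dg G W0 (c i) ≤ 2 := by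
    intro i hi
    by_contra h
    obtain ⟨v', hv', hne, hd, -, hL⟩ := hI3 (c i) (hcW i) (hA2 i hi) (by omega)
    exact link_false hG hc hcW hw hwc hA hmd hcomp halt hi hv' hne hd hL
  have hA3 : ∀ i, A i → 3 ≤ dg G W (c i) := by
    intro i hi
    obtain ⟨v, hv, hvi⟩ := (hA w hw hwc _).1 hi
    exact three_le_dg hc hcW hv.right.1 hv.right.2 hvi
  refine ⟨hW'W.trans hWW0, ⟨w, hTW' hwT⟩, by omega, ?_, ?_⟩
  · have h1 : (W'.filter (fun v => dg G W0 v ≤ 2)).card + Bs.card ≤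
        (W.filter (fun v => dg G W0 v ≤ 2)).card := by
      rw [← Finset.card_union_of_disjoint]
      · refine Finset.card_le_card (Finset.union_subset
          (Finset.filter_subset_filter _ hW'W) ?_)
        intro x hx
        obtain ⟨k, rfl, hk⟩ := (hBs x).1 hx
        exact Finset.mem_filter.2 ⟨hcW k, hB k hk⟩
      · rw [Finset.disjoint_left]
        intro x hx hx'
        obtain ⟨k, rfl, hk⟩ := (hBs x).1 hx'
        exact hcW' k hk (Finset.mem_filter.1 hx).1
    have h2 : (W0 \ W').card + W'.card = W0.card :=
      Finset.card_sdiff_add_card_eq_card (hW'W.trans hWW0)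
    have h3 : (W0 \ W').card + 2 * (W'.filter (fun v => dg G W0 v ≤ 2)).card ≤
      2 * df G W0 := by omega
    convert h3 using 3
  intro v hv hv2 hv3
  by_cases hold : dg G W v ≤ 2
  · obtain ⟨v', hv', hne, hd, hd3, hL⟩ := hI3 v (hW'W hv) hold hv3
    have hv'T : v' ∈ T := by
      refine (hT v').2 ⟨hv', ?_⟩
      rintro k rfl
      by_cases hk : A k
      · have := hA3 k hk
        omega
      · have := hB k hk
        omega
    exact ⟨v', hTW' hv'T, hne, (dg_mono hW'W v').trans hd, hd3, hL.mono hW'W⟩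
  set A1 := As.filter (fun a => ¬ 2 ≤ dg G T a) with hA1
  have hA1W : ∀ i, A i → (c i ∈ W' ∨ c i ∈ A1) := by
    intro i hi
    have h1 := (hAs (c i)).2 ⟨i, rfl, hi⟩
    by_cases h : 2 ≤ dg G T (c i)
    · exact Or.inl (mem_red.2 (Or.inr ⟨h1, h⟩))
    · exact Or.inr (Finset.mem_filter.2 ⟨h1, h⟩)
  have hA1n : ∀ x ∈ A1, x ∉ W' := by
    intro x hx hx'
    have h1 := Finset.mem_filter.1 hx
    rcases mem_red.1 hx' with h | ⟨-, h⟩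
    · exact Finset.disjoint_left.1 hTA h h1.1
    · exact h1.2 h
  have hadj1 : ∀ v x, x ∈ A1 → G.Adj v x → 1 ≤ dg G A1 v := by
    intro v x hx hvx
    exact Finset.card_pos.2 ⟨x, Finset.mem_filter.2 ⟨hx, hvx⟩⟩
  -- the deleted vertex responsible
  have hu1 : ∃ i, A i ∧ ((v = c i) ∨ (c i ∈ A1 ∧ v ∈ T ∧ G.Adj v (c i))) := by
    rcases mem_red.1 hv with h | ⟨h, -⟩
    · have h1 := hrT v h
      obtain ⟨u, hu, hvu, -⟩ := exists_of_dg (G := G) (W := A1) (v := v) (S := ∅)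
        (by simp only [Finset.card_empty]; omega)
      obtain ⟨i, rfl, hi⟩ := (hAs u).1 (Finset.mem_filter.1 hu).1
      exact ⟨i, hi, Or.inr ⟨hu, h, hvu⟩⟩
    · obtain ⟨i, hi, hi'⟩ := (hAs v).1 h
      exact ⟨i, hi', Or.inl hi⟩
  obtain ⟨i, hi, hvi⟩ := hu1
  have hi1 : ¬ A (i + 1) := by
    rw [halt]; simpa using hi
  have hi2 : A (i + 1 + 1) := (halt _).2 hi1
  have hne12 : c i ≠ c (i + 1 + 1) := by
    intro h
    have := hc.inj_window h (by omega) (by omega)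
    omega
  have hside : (v = c i) ∨ (c i ∉ W' ∧ G.Adj v (c i)) := by
    rcases hvi with h | ⟨h, -, h'⟩
    · exact Or.inl h
    · exact Or.inr ⟨hA1n _ h, h'⟩
  rcases hA1W _ hi2 with hk | hk
  · refine ⟨c (i + 1 + 1), hk, ?_, ?_, (hA3 _ hi2).trans (dg_mono hWW0 _),
      mkLink (hcW' _ hi1) hne12 (hc.adj _) (hc.adj _) hside (Or.inl rfl)⟩
    · rintro rfl
      rcases hvi with h | ⟨h, h2, -⟩
      · exact hne12 h.symm
      · exact ((hT _).1 h2).2 _ rfl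
    · rcases mem_red.1 hk with h | ⟨h, h'⟩
      · exact absurd rfl (((hT _).1 h).2 _)
      · have := hrA _ h h'
        omega
  · obtain ⟨v', hv', hv'i⟩ := (hA w hw hwc _).1 hi2
    have hv'T : v' ∈ T := (hT v').2 hv'.right
    have h1 := hrT v' hv'T
    have h2 := hadj1 v' _ hk hv'i
    have h3 := hleaf v' (hTW' hv'T)
    have h4 : 3 ≤ dg G W v' := by omega
    refine ⟨v', hTW' hv'T, ?_, by omega, h4.trans (dg_mono hWW0 _),
      mkLink (hcW' _ hi1) hne12 (hc.adj _) (hc.adj _) hside (Or.inr ⟨hA1n _ hk, hv'i⟩)⟩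
    rintro rfl
    rcases hvi with h | ⟨h, h5, h6⟩
    · exact ((hT _).1 hv'T).2 _ h
    · have : 2 ≤ dg G A1 v' := by
        have e : ({c i, c (i + 1 + 1)} : Finset V).card = 2 := Finset.card_pair hne12
        rw [← e]
        refine Finset.card_le_card ?_
        intro u hu
        simp only [Finset.mem_insert, Finset.mem_singleton] at hu
        rcases hu with rfl | rfl
        · exact Finset.mem_filter.2 ⟨h, h6⟩
        · exact Finset.mem_filter.2 ⟨hk, hv'i⟩
      omega

theorem step (hG : NoGP G) {W0 : Finset V} (hne : W0.Nonempty)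
    (IH : ∀ W', W'.Nonempty → W'.card < W0.card → Good G W') : Good G W0 := by
  classical
  have hI0 : Inv G W0 W0 := by
    refine ⟨subset_rfl, hne, le_rfl, ?_, fun v _ h h' => by omega⟩
    have : (W0.filter (fun v => dg G W0 v ≤ 2)).card ≤ df G W0 := by
      rw [df, Finset.card_eq_sum_ones]
      refine le_trans (Finset.sum_le_sum (g := fun v => 3 - dg G W0 v) ?_)
        (Finset.sum_le_sum_of_subset (Finset.filter_subset _ _))
      intro x hx
      have := (Finset.mem_filter.1 hx).2
      omega
    have h3 : (W0 \ W0).card + 2 * (W0.filter (fun v => dg G W0 v ≤ 2)).card ≤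
      2 * df G W0 := by simp; omega
    convert h3 using 3
  obtain ⟨W, hW, hmin⟩ := Finset.exists_min_image (W0.powerset.filter (Inv G W0)) Finset.card
    ⟨W0, by simp [hI0]⟩
  simp only [Finset.mem_filter, Finset.mem_powerset] at hW hmin
  obtain ⟨hWW0, hI⟩ := hW
  have hI' := hI
  obtain ⟨-, hWne, hdfle, hI2, -⟩ := hI'
  have hcW0W : (W0 \ W).card + W.card = W0.card := Finset.card_sdiff_add_card_eq_card hWW0
  have hsd : (W0 \ W).card ≤ 2 * df G W0 := by
    refine le_trans (le_of_eq ?_) (le_trans (Nat.le_add_right _ _) hI2)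
    congr
  by_cases h1 : df G W < df G W0
  · refine good_fin (IH W hWne ?_) h1 (by omega)
    rcases Nat.lt_or_ge W.card W0.card with h | h
    · exact h
    · rw [Finset.eq_of_subset_of_card_le hWW0 h] at h1
      omega
  have hdf : df G W = df G W0 := by omega
  -- generic leaf removal
  have hleaf : ∀ W' : Finset V, W'.Nonempty → W'.card ≤ W0.card → df G W' ≤ df G W0 →
      W0.card ≤ W'.card + 4 * df G W0 → (∃ v ∈ W', dg G W' v ≤ 1) → Good G W0 := by
    rintro W' hne' hle hdf' hc' ⟨v, hv, hv1⟩
    have hlt := df_leaf hv hv1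
    have hce : (W'.erase v).card + 1 = W'.card := Finset.card_erase_add_one hv
    by_cases he : (W'.erase v).Nonempty
    · exact good_fin (IH _ he (by omega)) (by omega) (by omega)
    · rw [Finset.not_nonempty_iff_eq_empty] at he
      have : W' = {v} := by
        rw [← Finset.insert_erase hv, he]
        rfl
      rw [this, df_singleton] at hdf'
      rw [he, Finset.card_empty] at hce
      exact good_small hdf' (by omega)
  by_cases h3 : ∃ v ∈ W, dg G W v ≤ 1
  · exact hleaf W hWne (by omega) (by omega) (by omega) h3
  have hdg2 : ∀ v ∈ W, 2 ≤ dg G W v := by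
    intro v hv
    by_contra h
    exact h3 ⟨v, hv, by omega⟩
  rcases struct hWne hdg2 with h | h | ⟨m, c, hc, hcW, ⟨w, hw, hwc⟩, A, hA, hA2⟩
  · exact good_small (by omega) (by omega)
  · obtain ⟨W₁, W₂, n1, n2, c1, c2, hcc, hdd⟩ := h
    exact good_split (IH W₁ n1 (by omega)) (IH W₂ n2 (by omega)) (by omega) (by omega)
  · obtain ⟨W', n', c', d', e', h⟩ := hI.cyc hG hdf hdg2 hc hcW hw hwc hA hA2
    rcases h with h | h | h
    · exact good_fin (IH W' n' (by omega)) h (by omega)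
    · exact hleaf W' n' (by omega) d' e' h
    · have := hmin W' ⟨h.1, h⟩
      omega

theorem good_all (hG : NoGP G) : ∀ n : ℕ, ∀ W : Finset V, W.Nonempty → W.card = n → Good G W := by
  intro n
  induction n using Nat.strong_induction_on with
  | _ n ih =>
    intro W hW hn
    exact step hG hW fun W' h h' => ih W'.card (by omega) W' h rfl

end mainproof

section final
variable {V : Type*}

theorem df_delete [Fintype V] [DecidableEq V] (G : SimpleGraph V) [DecidableRel G.Adj]
    (hdeg : 3 ≤ G.minDegree) (E' : Finset (Sym2 V)) :
    df (G.deleteEdges (↑E' : Set (Sym2 V))) Finset.univ ≤ 2 * E'.card := by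
  classical
  have h1 : ∀ v, 3 - dg (G.deleteEdges (↑E' : Set (Sym2 V))) Finset.univ v ≤
      (E'.filter (fun e => v ∈ e)).card := by
    intro v
    have hv : 3 ≤ G.degree v := hdeg.trans (G.minDegree_le_degree v)
    have h2 : G.degree v ≤ dg (G.deleteEdges (↑E' : Set (Sym2 V))) Finset.univ v +
        (Finset.univ.filter (fun u => s(v, u) ∈ E')).card := by
      unfold dg
      rw [← G.card_neighborFinset_eq_degree]
      refine le_trans (Finset.card_le_card ?_) (Finset.card_union_le _ _)
      intro u hu
      rw [SimpleGraph.mem_neighborFinset] at hu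
      simp only [Finset.mem_union, Finset.mem_filter, Finset.mem_univ, true_and,
        SimpleGraph.deleteEdges_adj, Finset.mem_coe]
      tauto
    have h3 : (Finset.univ.filter (fun u => s(v, u) ∈ E')).card ≤
        (E'.filter (fun e => v ∈ e)).card := by
      refine Finset.card_le_card_of_injOn (fun u => s(v, u)) ?_ ?_
      · intro u hu
        simpa using hu
      · intro a _ b _ hab
        simp only [Sym2.eq_iff] at hab
        rcases hab with h | h
        · exact h.2
        · exact h.2.trans h.1
    omega
  calc df (G.deleteEdges (↑E' : Set (Sym2 V))) Finset.univ
      ≤ ∑ v, (E'.filter (fun e => v ∈ e)).card := Finset.sum_le_sum fun v _ => h1 v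
    _ = ∑ e ∈ E', (Finset.univ.filter (fun v => v ∈ e)).card :=
        Finset.sum_card_bipartiteAbove_eq_sum_card_bipartiteBelow (fun v e => v ∈ e)
    _ ≤ ∑ e ∈ E', 2 := by
        refine Finset.sum_le_sum fun e _ => ?_
        induction e using Sym2.ind with
        | _ a b =>
          refine (Finset.card_le_card (t := {a, b}) ?_).trans Finset.card_le_two
          intro x hx
          simpa using hx
    _ = 2 * E'.card := by simp [mul_comm]

end final

end Resil

/-- Resilience version: if `G` is an `n`-vertex graph with minimum degree at
least three and `n ≥ 45`, then after deleting any set of at most `√n / 5`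
edges, the remaining graph still contains two cycles whose lengths differ by
one or two. -/
theorem resilience {V : Type*} [Fintype V] [DecidableEq V]
    (G : SimpleGraph V) [DecidableRel G.Adj]
    (hdeg : 3 ≤ G.minDegree)
    (hn : 45 ≤ Fintype.card V)
    (E' : Finset (Sym2 V))
    (hE' : (E'.card : ℝ) ≤ Real.sqrt (Fintype.card V) / 5) :
    HasGoodPair (G.deleteEdges ↑E') := by
  by_contra hno
  have hG := Resil.noGP_of_not hno
  have hne : (Finset.univ : Finset V).Nonempty := by
    rw [← Finset.card_pos, Finset.card_univ]; omega
  obtain ⟨e, he1, he2, he3⟩ := Resil.good_all hG _ Finset.univ hne rfl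
  have h1 := Resil.df_delete G hdeg E'
  rw [Finset.card_univ] at he3
  have h2 : 25 * E'.card ^ 2 ≤ Fintype.card V := by
    have h3 : (5 * (E'.card : ℝ)) ^ 2 ≤ Fintype.card V := by
      refine (Real.le_sqrt (by positivity) (by positivity)).1 ?_
      linarith
    have h4 : ((25 * E'.card ^ 2 : ℕ) : ℝ) ≤ (Fintype.card V : ℝ) := by
      push_cast
      linarith
    exact_mod_cast h4
  have h5 : e + 2 ≤ 2 * E'.card := by omega
  nlinarith
end

section
/- Let G be a 2-connected graph, not a cycle, and let C be an induced cycle in G such that some bridge B of C has as many internal vertices as possible. Then either B is the only bridge of C, or B meets C in exactly two vertices u, v and every other bridge of C is a path from u to v. -/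
variable {V : Type*}

/-- A graph is 2-connected if it has at least 3 vertices and remains connected
after deleting any single vertex. -/
def TwoConnected [Fintype V] (G : SimpleGraph V) : Prop :=
  3 ≤ Fintype.card V ∧ ∀ v : V, (G.induce {u | u ≠ v}).Connected

/-- `B` is a *bridge* of the cycle `c` in `G`: either `B` is a chord of `c`
(an edge of `G` joining two vertices of `c` that is not an edge of `c`), or
`B` is obtained from a connected component `K` of `G − V(c)` by adding all
edges between `K` and `c`. -/
def IsBridgeOf {v : V} (G : SimpleGraph V) (c : G.Walk v v) (B : G.Subgraph) :
    Prop :=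
  (∃ a b : V, a ∈ c.support ∧ b ∈ c.support ∧ G.Adj a b ∧
      ¬ c.toSubgraph.Adj a b ∧ B.verts = {a, b} ∧
      (∀ x y : V, B.Adj x y ↔ (x = a ∧ y = b) ∨ (x = b ∧ y = a))) ∨
  (∃ (x₀ : {x : V // x ∉ c.support}),
    ∃ K : Set V,
      K = Subtype.val ''
        ((G.induce {x : V | x ∉ c.support}).connectedComponentMk x₀).supp ∧
      B.verts = K ∪ {s : V | s ∈ c.support ∧ ∃ w ∈ K, G.Adj s w} ∧
      (∀ x y : V, B.Adj x y ↔ G.Adj x y ∧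
        ((x ∈ K ∧ y ∈ K) ∨ (x ∈ K ∧ y ∈ c.support) ∨
          (x ∈ c.support ∧ y ∈ K))))

/-- The set of internal vertices of a bridge `B` of the cycle `c`, i.e. the
vertices of `B` not on `c`. -/
def internalVerts {v : V} (G : SimpleGraph V) (c : G.Walk v v)
    (B : G.Subgraph) : Set V :=
  B.verts \ {x : V | x ∈ c.support}

open SimpleGraph

/-- The graph `G` restricted to edges inside `S`. -/
def resG (G : SimpleGraph V) (S : Set V) : SimpleGraph V where
  Adj x y := G.Adj x y ∧ x ∈ S ∧ y ∈ S
  symm := ⟨fun _ _ h => ⟨h.1.symm, h.2.2, h.2.1⟩⟩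
  loopless := ⟨fun _ h => h.1.ne rfl⟩

theorem resG_le (G : SimpleGraph V) (S : Set V) : resG G S ≤ G := fun _ _ h => h.1

/-- `K` is a connected component of `G - C`. -/
structure CompOf (G : SimpleGraph V) (C K : Set V) : Prop where
  ne : K.Nonempty
  disj : ∀ x ∈ K, x ∉ C
  closed : ∀ x ∈ K, ∀ y, G.Adj x y → y ∉ C → y ∈ K
  conn : ∀ x ∈ K, ∀ y ∈ K, (resG G K).Reachable x y

theorem reach_of_walk {G : SimpleGraph V} {S : Set V} {x y : V} (p : G.Walk x y)
    (h : ∀ z ∈ p.support, z ∈ S) : (resG G S).Reachable x y := by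
  induction p with
  | nil => exact Reachable.refl _
  | cons hadj p ih =>
    have h1 : (resG G S).Adj _ _ := ⟨hadj, h _ (by simp), h _ (by simp)⟩
    exact h1.reachable.trans (ih fun z hz => h z (by simp [hz]))

theorem walk_support_resG {G : SimpleGraph V} {S : Set V} {x y : V} (p : (resG G S).Walk x y)
    (hx : x ∈ S) : ∀ z ∈ p.support, z ∈ S := by
  induction p with
  | nil => simpa using hx
  | cons hadj p ih =>
    intro z hz
    simp only [Walk.support_cons, List.mem_cons] at hz
    rcases hz with rfl | hz
    · exact hx
    · exact ih hadj.2.2 z hz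

theorem compOf_of_component {G : SimpleGraph V} {C : Set V} (x₀ : {x : V // x ∉ C}) :
    CompOf G C (Subtype.val ''
      ((G.induce {x : V | x ∉ C}).connectedComponentMk x₀).supp) := by
  set H := G.induce {x : V | x ∉ C}
  set K : Set V := Subtype.val '' (H.connectedComponentMk x₀).supp with hK
  have hcl : ∀ x y : {x : V // x ∉ C}, x.1 ∈ K → H.Adj x y → y.1 ∈ K := by
    rintro x y ⟨x', hx', hxx⟩ hxy
    obtain rfl : x' = x := Subtype.ext hxx
    refine ⟨y, ?_, rfl⟩
    rw [ConnectedComponent.mem_supp_iff] at hx' ⊢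
    rw [← hx']
    exact ConnectedComponent.sound hxy.symm.reachable
  have hw : ∀ (x y : {x : V // x ∉ C}) (p : H.Walk x y), x.1 ∈ K →
      (resG G K).Reachable x.1 y.1 := by
    intro x y p
    induction p with
    | nil => intro _; exact Reachable.refl _
    | @cons a b _ hadj p ih =>
      intro hx
      have hb := hcl _ _ hx hadj
      have h1 : (resG G K).Adj a.1 b.1 := ⟨hadj, hx, hb⟩
      exact h1.reachable.trans (ih hb)
  refine ⟨⟨x₀.1, x₀, by simp, rfl⟩, ?_, ?_, ?_⟩
  · rintro x ⟨x', _, rfl⟩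
    exact x'.2
  · rintro x hx y hxy hy
    obtain ⟨x', hx', rfl⟩ := id hx
    exact hcl x' ⟨y, hy⟩ hx hxy
  · rintro x hx y hy
    obtain ⟨x', hx', rfl⟩ := id hx
    obtain ⟨y', hy', rfl⟩ := id hy
    rw [ConnectedComponent.mem_supp_iff] at hx' hy'
    obtain ⟨p⟩ := ConnectedComponent.exact (hx'.trans hy'.symm)
    exact hw x' y' p hx

theorem CompOf.eq_of_mem {G : SimpleGraph V} {C K L : Set V} (hK : CompOf G C K)
    (hL : CompOf G C L) {z : V} (hzK : z ∈ K) (hzL : z ∈ L) : K ⊆ L := by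
  intro y hy
  obtain ⟨p⟩ := hK.conn z hzK y hy
  clear hy
  induction p with
  | nil => exact hzL
  | cons hadj p ih =>
    exact ih hadj.2.2 (hL.closed _ hzL _ hadj.1 (hK.disj _ hadj.2.2))

theorem closed_all [Fintype V] {G : SimpleGraph V} (h2 : TwoConnected G) (t : V) (S : Set V)
    (s : V) (hs : s ∈ S) (hst : s ≠ t)
    (hcl : ∀ x ∈ S, x ≠ t → ∀ y, G.Adj x y → y ≠ t → y ∈ S) (y : V) (hy : y ≠ t) : y ∈ S := by
  obtain ⟨p⟩ := (h2.2 t).preconnected ⟨s, hst⟩ ⟨y, hy⟩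
  have : ∀ (a b : {u : V | u ≠ t}) (p : (G.induce {u | u ≠ t}).Walk a b), a.1 ∈ S → b.1 ∈ S := by
    intro a b p
    induction p with
    | nil => exact id
    | @cons a b _ hadj p ih => exact fun ha => ih (hcl _ ha a.2 _ hadj b.2)
  exact this _ _ p hs

theorem exists_attach [Fintype V] {G : SimpleGraph V} (h2 : TwoConnected G) {C K : Set V}
    (hK : CompOf G C K) (hC : ∀ t, ∃ y ∈ C, y ≠ t) (t : V) (ht : t ∈ C) :
    ∃ a ∈ C, a ≠ t ∧ ∃ k ∈ K, G.Adj a k := by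
  by_contra hno
  push Not at hno
  obtain ⟨s, hs⟩ := hK.ne
  obtain ⟨y, hy, hyt⟩ := hC t
  refine hK.disj y (closed_all h2 t K s hs ?_ ?_ y hyt) hy
  · rintro rfl; exact hK.disj _ hs ht
  · intro x hx _ y hxy hyt
    refine hK.closed x hx y hxy fun hyC => hno y hyC hyt x hx hxy.symm

theorem min_cycle_chordless [DecidableEq V] {H : SimpleGraph V} {a : V} (c : H.Walk a a)
    (hc : c.IsCycle)
    (hg : H.girth = c.length) (x y : V) (hx : x ∈ c.support) (hy : y ∈ c.support)
    (hxy : H.Adj x y) : s(x, y) ∈ c.edges := by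
  rw [← Walk.adj_toSubgraph_iff_mem_edges, ← Walk.toSubgraph_rotate c hx,
    Walk.adj_toSubgraph_iff_mem_edges]
  have hy' : y ∈ (c.rotate x hx).support := by rwa [Walk.mem_support_rotate_iff]
  have hc' := hc.rotate hx
  have hg' : H.girth = (c.rotate x hx).length := by rw [hg, Walk.length_rotate]
  generalize c.rotate x hx = d at *
  cases d with
  | nil => simp at hc'
  | @cons _ b _ h p =>
    rw [Walk.cons_isCycle_iff] at hc'
    have hyp : y ∈ p.support := by
      simp only [Walk.support_cons, List.mem_cons] at hy'
      rcases hy' with rfl | h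
      · exact absurd rfl hxy.ne
      · exact h
    by_contra hne
    have hq : (Walk.cons h (p.takeUntil y hyp)).IsPath := by
      rw [Walk.cons_isPath_iff]
      exact ⟨hc'.1.takeUntil hyp, Walk.endpoint_notMem_support_takeUntil hc'.1 hyp hxy.ne⟩
    have hcyc : (Walk.cons hxy.symm (Walk.cons h (p.takeUntil y hyp))).IsCycle := by
      rw [Walk.cons_isCycle_iff]
      refine ⟨hq, fun hmem => hne ?_⟩
      rw [Sym2.eq_swap] at hmem
      simp only [Walk.edges_cons, List.mem_cons] at hmem ⊢
      exact hmem.imp id fun h => Walk.edges_takeUntil_subset_edges _ hyp h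
    have hl := girth_le_length hcyc
    have hs := congrArg Walk.length (p.take_spec hyp)
    simp only [Walk.length_append, Walk.length_cons] at hs hl hg'
    have hd : ∀ e ∈ (p.dropUntil y hyp).edges, e ∈ p.edges :=
      fun e he => Walk.edges_dropUntil_subset_edges _ hyp he
    apply hne
    simp only [Walk.edges_cons, List.mem_cons]
    right
    apply hd
    have hle : (p.dropUntil y hyp).length ≤ 1 := by omega
    generalize p.dropUntil y hyp = r at hle
    cases r with
    | nil => exact absurd rfl hxy.ne
    | cons h' r' =>
      cases r' with
      | nil => simp [Sym2.eq_swap]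
      | cons _ _ => simp at hle

/-- The component bridge with vertex set `K` off the cycle. -/
def mkBridge (G : SimpleGraph V) (C K : Set V) : G.Subgraph where
  verts := K ∪ {s | s ∈ C ∧ ∃ w ∈ K, G.Adj s w}
  Adj x y := G.Adj x y ∧ ((x ∈ K ∧ y ∈ K) ∨ (x ∈ K ∧ y ∈ C) ∨ (x ∈ C ∧ y ∈ K))
  adj_sub h := h.1
  edge_vert := by
    rintro x y ⟨h, h1 | h1 | h1⟩
    · exact Or.inl h1.1
    · exact Or.inl h1.1
    · exact Or.inr ⟨h1.1, y, h1.2, h⟩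
  symm := ⟨by
    rintro x y ⟨h, h1⟩
    exact ⟨h.symm, by tauto⟩⟩

/-- Removing an attachment of a largest bridge destroys all cycles avoiding the bridge. -/
theorem acyclic_of_max [Fintype V] [DecidableEq V] {G : SimpleGraph V} {C K S : Set V} {a : V}
    {N : ℕ} (hN : N = K.ncard)
    (hmax : ∀ (w : V) (c' : G.Walk w w), c'.IsCycle →
      c'.toSubgraph.IsInduced → ∀ B' : G.Subgraph, IsBridgeOf G c' B' →
      (internalVerts G c' B').ncard ≤ N)
    (hK : CompOf G C K) (haC : a ∈ C) (ha : ∃ k ∈ K, G.Adj a k)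
    (hSK : ∀ x ∈ K, x ∉ S) (haS : a ∉ S) : (resG G S).IsAcyclic := by
  by_contra hcon
  obtain ⟨w, c', hc', hg⟩ := exists_girth_eq_length.mpr hcon
  have hsup : ∀ z ∈ c'.support, z ∈ S := by
    have hw : w ∈ S := by
      cases c' with
      | nil => simp at hc'
      | cons h p => exact h.2.1
    exact walk_support_resG c' hw
  set d := c'.mapLe (resG_le G S) with hd
  have hds : d.support = c'.support := Walk.support_mapLe_eq_support _ _
  have hdc : d.IsCycle := hc'.mapLe _
  have hdi : d.toSubgraph.IsInduced := by
    intro x hx y hy hxy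
    rw [Walk.mem_verts_toSubgraph, hds] at hx hy
    rw [Walk.adj_toSubgraph_mapLe, Walk.adj_toSubgraph_iff_mem_edges]
    exact min_cycle_chordless c' hc' hg x y hx hy ⟨hxy, hsup x hx, hsup y hy⟩
  obtain ⟨k, hk, hak⟩ := ha
  have hkd : ∀ x ∈ K, x ∉ d.support := fun x hx h => hSK x hx (hsup x (hds ▸ h))
  have had : a ∉ d.support := fun h => haS (hsup a (hds ▸ h))
  let x₀ : {x : V // x ∉ d.support} := ⟨k, hkd k hk⟩
  set L : Set V := Subtype.val ''
      ((G.induce {x : V | x ∉ d.support}).connectedComponentMk x₀).supp with hLdef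
  have hL : CompOf G {x | x ∈ d.support} L := compOf_of_component (C := {x | x ∈ d.support}) x₀
  have hkL : k ∈ L := ⟨x₀, by simp, rfl⟩
  have hKL : K ⊆ L := by
    intro y hy
    obtain ⟨p⟩ := hK.conn k hk y hy
    clear hy
    clear_value L x₀
    clear hLdef hak
    induction p with
    | nil => exact hkL
    | cons hadj p ih =>
      exact ih hadj.2.2 (hL.closed _ hkL _ hadj.1 (hkd _ hadj.2.2))
  have haL : a ∈ L := hL.closed k hkL a hak.symm had
  have hb : IsBridgeOf G d (mkBridge G {x | x ∈ d.support} L) :=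
    Or.inr ⟨x₀, L, hLdef, rfl, fun x y => Iff.rfl⟩
  have hle := hmax w d hdc hdi _ hb
  have hsub : insert a K ⊆ internalVerts G d (mkBridge G {x | x ∈ d.support} L) := by
    intro z hz
    have hzL : z ∈ L := by
      rcases hz with rfl | hz
      · exact haL
      · exact hKL hz
    exact ⟨Or.inl hzL, hL.disj z hzL⟩
  have h1 := Set.ncard_le_ncard hsub (Set.toFinite _)
  rw [Set.ncard_insert_of_notMem (fun h => hK.disj a h haC) (Set.toFinite _)] at h1
  omega

theorem cycle_minus_conn [DecidableEq V] {G : SimpleGraph V} {v : V} (c : G.Walk v v)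
    (hc : c.IsCycle)
    (a : V) (ha : a ∈ c.support) (x y : V) (hx : x ∈ c.support) (hy : y ∈ c.support)
    (hxa : x ≠ a) (hya : y ≠ a) :
    (resG G ({z | z ∈ c.support} \ {a})).Reachable x y := by
  have hs : ∀ z, z ∈ (c.rotate a ha).support ↔ z ∈ c.support :=
    fun z => Walk.mem_support_rotate_iff c a ha
  have hc' := hc.rotate ha
  rw [← hs] at hx hy
  generalize c.rotate a ha = d at *
  cases d with
  | nil => simp at hc'
  | @cons _ b _ h p =>
    rw [Walk.cons_isCycle_iff] at hc'
    have key : ∀ x, x ∈ (Walk.cons h p).support → x ≠ a →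
        (resG G ({z | z ∈ c.support} \ {a})).Reachable b x := by
      intro x hx hxa
      have hxp : x ∈ p.support := by
        simp only [Walk.support_cons, List.mem_cons] at hx
        exact hx.resolve_left hxa
      apply reach_of_walk (p.takeUntil x hxp)
      intro z hz
      refine ⟨(hs z).1 ?_, ?_⟩
      · simp only [Walk.support_cons, List.mem_cons]
        exact Or.inr (Walk.support_takeUntil_subset_support _ hxp hz)
      · rintro rfl
        exact Walk.endpoint_notMem_support_takeUntil hc'.1 hxp hxa.symm hz
    exact (key x hx hxa).symm.trans (key y hy hya)

/-- In an acyclic graph, two disjoint connected sets are joined by at most one edge. -/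
theorem unique_edge {G : SimpleGraph V} {S X Y : Set V} (hac : (resG G S).IsAcyclic)
    (hX : X ⊆ S) (hY : Y ⊆ S) (hd : ∀ z ∈ X, z ∉ Y) {k₁ k₂ c₁ c₂ : V}
    (hk₁ : k₁ ∈ X) (hk₂ : k₂ ∈ X) (hc₁ : c₁ ∈ Y) (hc₂ : c₂ ∈ Y)
    (hk : (resG G X).Reachable k₁ k₂) (hc : (resG G Y).Reachable c₂ c₁)
    (h₁ : G.Adj k₁ c₁) (h₂ : G.Adj k₂ c₂) : k₁ = k₂ ∧ c₁ = c₂ := by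
  by_contra hne
  have hb := isAcyclic_iff_forall_adj_isBridge.mp hac
    (show (resG G S).Adj k₁ c₁ from ⟨h₁, hX hk₁, hY hc₁⟩)
  rw [isBridge_iff] at hb
  apply hb
  have l1 : resG G X ≤ (resG G S).deleteEdges {s(k₁, c₁)} := by
    intro x y hxy
    rw [deleteEdges_adj]
    refine ⟨⟨hxy.1, hX hxy.2.1, hX hxy.2.2⟩, ?_⟩
    have := hxy.2
    have := hd c₁
    simp only [Set.mem_singleton_iff, Sym2.eq_iff]
    rintro (⟨rfl, rfl⟩ | ⟨rfl, rfl⟩) <;> tauto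
  have l2 : resG G Y ≤ (resG G S).deleteEdges {s(k₁, c₁)} := by
    intro x y hxy
    rw [deleteEdges_adj]
    refine ⟨⟨hxy.1, hY hxy.2.1, hY hxy.2.2⟩, ?_⟩
    have := hxy.2
    have := hd k₁ hk₁
    simp only [Set.mem_singleton_iff, Sym2.eq_iff]
    rintro (⟨rfl, rfl⟩ | ⟨rfl, rfl⟩) <;> tauto
  have l3 : ((resG G S).deleteEdges {s(k₁, c₁)}).Adj k₂ c₂ := by
    rw [deleteEdges_adj]
    refine ⟨⟨h₂, hX hk₂, hY hc₂⟩, ?_⟩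
    have := hd k₂ hk₂
    simp only [Set.mem_singleton_iff, Sym2.eq_iff]
    rintro (⟨rfl, rfl⟩ | ⟨rfl, rfl⟩) <;> tauto
  exact (hk.mono l1).trans (l3.reachable.trans (hc.mono l2))

/-- A tree component with exactly two edges to the rest is a path. -/
theorem edge_on_path [Fintype V] [DecidableEq V] {G : SimpleGraph V} (h2 : TwoConnected G)
    {C K : Set V} (hK : CompOf G C K) (hac : (resG G K).IsAcyclic) {u x₀ y₀ : V}
    (huC : u ∈ C) (hnb : ∀ k ∈ K, ∀ z ∈ C, G.Adj k z → k = x₀ ∨ k = y₀)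
    (q : (resG G K).Walk x₀ y₀) (a b : V) (hab : (resG G K).Adj a b) : s(a, b) ∈ q.edges := by
  by_contra hne
  set D := (resG G K).deleteEdges {s(a, b)} with hD
  have hb : ¬ D.Reachable a b := isBridge_iff.mp (isAcyclic_iff_forall_adj_isBridge.mp hac hab)
  have hxy : D.Reachable x₀ y₀ := ⟨q.toDeleteEdges {s(a, b)} (by
    intro e he h
    rw [Set.mem_singleton_iff] at h
    exact hne (h ▸ he))⟩
  -- the side of `s` not containing `x₀` is closed
  have main : ∀ s t : V, (resG G K).Adj s t → D = (resG G K).deleteEdges {s(s, t)} →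
      ¬ D.Reachable s t → ¬ D.Reachable s x₀ → False := by
    intro s t hst hDs hr hx
    have := closed_all h2 t {z | z ∈ K ∧ D.Reachable s z} s ⟨hst.2.1, Reachable.refl _⟩ hst.1.ne
      (by
        rintro x ⟨hxK, hsx⟩ hxt y hadj hyt
        have hyC : y ∉ C := by
          intro hyC
          rcases hnb x hxK y hyC hadj with rfl | rfl
          · exact hx hsx
          · exact hx (hsx.trans hxy.symm)
        have hyK := hK.closed x hxK y hadj hyC
        refine ⟨hyK, hsx.trans (Adj.reachable ?_)⟩
        rw [hDs, deleteEdges_adj]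
        refine ⟨⟨hadj, hxK, hyK⟩, ?_⟩
        simp only [Set.mem_singleton_iff, Sym2.eq_iff]
        rintro (⟨_, h⟩ | ⟨h, _⟩)
        · exact hyt h
        · exact hxt h)
      u (by rintro rfl; exact hK.disj _ hst.2.2 huC)
    exact hK.disj u this.1 huC
  by_cases h : D.Reachable a x₀
  · refine main b a hab.symm (by rw [hD, Sym2.eq_swap]) (fun h => hb h.symm) fun h' => ?_
    exact hb (h.trans h'.symm)
  · exact main a b hab hD hb h

theorem bridge_comp {v : V} {G : SimpleGraph V} {c : G.Walk v v}
    (hind : c.toSubgraph.IsInduced) {B : G.Subgraph} (hB : IsBridgeOf G c B) :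
    ∃ K, CompOf G {x | x ∈ c.support} K ∧ B = mkBridge G {x | x ∈ c.support} K := by
  rcases hB with ⟨a, b, ha, hb, hab, hn, _⟩ | ⟨x₀, K, hK, hv, hadj⟩
  · exact absurd (hind (by simpa using ha) (by simpa using hb) hab) hn
  · refine ⟨K, hK ▸ compOf_of_component (C := {x | x ∈ c.support}) x₀, ?_⟩
    apply Subgraph.ext
    · exact hv
    · ext x y; exact hadj x y

/-- Bondy–Vince lemma: let `G` be a 2-connected graph, not a cycle, and let
`c` be an induced cycle in `G` some bridge `B` of which has as many internal
vertices as possible (over all induced cycles and their bridges). Then either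
`B` is the only bridge of `c`, or `B` meets `c` in exactly two vertices
`u, w` and every other bridge of `c` is a path from `u` to `w`. -/
theorem bondy_vince_lemma [Fintype V] [DecidableEq V]
    (G : SimpleGraph V)
    (h2 : TwoConnected G)
    (hnc : ¬ ∃ n : ℕ, 3 ≤ n ∧ Nonempty (G ≃g SimpleGraph.cycleGraph n))
    (v : V) (c : G.Walk v v) (hc : c.IsCycle) (hind : c.toSubgraph.IsInduced)
    (B : G.Subgraph) (hB : IsBridgeOf G c B)
    (hmax : ∀ (w : V) (c' : G.Walk w w), c'.IsCycle →
      c'.toSubgraph.IsInduced → ∀ B' : G.Subgraph, IsBridgeOf G c' B' →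
      (internalVerts G c' B').ncard ≤ (internalVerts G c B).ncard) :
    (∀ B' : G.Subgraph, IsBridgeOf G c B' → B' = B) ∨
    (∃ u w : V, u ≠ w ∧ B.verts ∩ {x : V | x ∈ c.support} = {u, w} ∧
      ∀ B' : G.Subgraph, IsBridgeOf G c B' → B' ≠ B →
        ∃ p : G.Walk u w, p.IsPath ∧ p.toSubgraph = B') := by
  classical
  set C : Set V := {x | x ∈ c.support} with hCdef
  obtain ⟨K, hK, rfl⟩ := bridge_comp hind hB
  have hint : internalVerts G c (mkBridge G C K) = K := by
    ext x
    constructor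
    · rintro ⟨h | h, hx⟩
      · exact h
      · exact absurd h.1 hx
    · exact fun h => ⟨Or.inl h, hK.disj x h⟩
  rw [hint] at hmax
  have hC : ∀ t, ∃ y ∈ C, y ≠ t := by
    intro t
    by_cases hv : v = t
    · subst hv
      cases c with
      | nil => simp at hc
      | @cons _ b _ h p => exact ⟨b, by simp [C], h.ne.symm⟩
    · exact ⟨v, by simp [C], hv⟩
  have two : ∀ L, CompOf G C L → ∃ a ∈ C, ∃ b ∈ C, a ≠ b ∧ (∃ k ∈ L, G.Adj a k) ∧
      ∃ k ∈ L, G.Adj b k := by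
    intro L hL
    obtain ⟨a, ha, _, hak⟩ := exists_attach h2 hL hC v (by simp [C])
    obtain ⟨b, hb, hba, hbk⟩ := exists_attach h2 hL hC a ha
    exact ⟨a, ha, b, hb, hba.symm, hak, hbk⟩
  -- for another component, the edges to `C - a` are unique
  have hdisj : ∀ L, CompOf G C L → L ≠ K → ∀ z ∈ K, z ∉ L := fun L hL hne z hzK hzL =>
    hne ((hL.eq_of_mem hK hzL hzK).antisymm (hK.eq_of_mem hL hzK hzL))
  have hacy : ∀ L, CompOf G C L → L ≠ K → ∀ a ∈ C, (∃ k ∈ K, G.Adj a k) →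
      (resG G (L ∪ (C \ {a}))).IsAcyclic := by
    intro L hL hne a ha hak
    refine acyclic_of_max rfl hmax hK ha hak ?_ ?_
    · rintro x hx (h | h)
      · exact hdisj L hL hne x hx h
      · exact hK.disj x hx h.1
    · rintro (h | h)
      · exact hL.disj a h ha
      · exact h.2 rfl
  have huniq : ∀ L, CompOf G C L → L ≠ K → ∀ a ∈ C, (∃ k ∈ K, G.Adj a k) →
      ∀ k₁ ∈ L, ∀ k₂ ∈ L, ∀ c₁ ∈ C, ∀ c₂ ∈ C, c₁ ≠ a → c₂ ≠ a → G.Adj c₁ k₁ → G.Adj c₂ k₂ →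
      k₁ = k₂ ∧ c₁ = c₂ := by
    intro L hL hne a ha hak k₁ hk₁ k₂ hk₂ c₁ hc₁ c₂ hc₂ h₁ h₂ e₁ e₂
    exact unique_edge (hacy L hL hne a ha hak) Set.subset_union_left Set.subset_union_right
      (fun z hz hz' => hL.disj z hz hz'.1) hk₁ hk₂ ⟨hc₁, h₁⟩ ⟨hc₂, h₂⟩
      (hL.conn _ hk₁ _ hk₂) (cycle_minus_conn c hc a ha c₂ c₁ hc₂ hc₁ h₂ h₁) e₁.symm e₂.symm
  -- attachments of `K` are attachments of `L`
  have hatt : ∀ L, CompOf G C L → L ≠ K → ∀ a ∈ C, (∃ k ∈ K, G.Adj a k) →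
      (∃ k ∈ L, G.Adj a k) := by
    intro L hL hne a ha hak
    obtain ⟨p, hp, q, hq, hpq, ⟨k, hk, hpk⟩, ⟨l, hl, hql⟩⟩ := two L hL
    by_contra hno
    have h1 : p ≠ a := by rintro rfl; exact hno ⟨k, hk, hpk⟩
    have h2 : q ≠ a := by rintro rfl; exact hno ⟨l, hl, hql⟩
    exact hpq (huniq L hL hne a ha hak k hk l hl p hp q hq h1 h2 hpk hql).2
  by_cases hall : ∀ B' : G.Subgraph, IsBridgeOf G c B' → B' = mkBridge G C K
  · exact Or.inl hall
  right
  push Not at hall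
  obtain ⟨B₁, hB₁, hne₁⟩ := hall
  obtain ⟨L₁, hL₁, rfl⟩ := bridge_comp hind hB₁
  have hLK₁ : L₁ ≠ K := by rintro rfl; exact hne₁ rfl
  obtain ⟨u, hu, w, hw, huw, huk, hwk⟩ := two K hK
  -- attachments of any other component lie in {u, w}
  have honly : ∀ L, CompOf G C L → L ≠ K → ∀ z ∈ C, (∃ k ∈ L, G.Adj z k) → z = u ∨ z = w := by
    intro L hL hne z hz ⟨k, hk, hzk⟩
    by_contra hno
    push Not at hno
    obtain ⟨l, hl, hwl⟩ := hatt L hL hne w hw hwk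
    exact hno.2 (huniq L hL hne u hu huk k hk l hl z hz w hw hno.1 huw.symm hzk hwl).2
  refine ⟨u, w, huw, ?_, ?_⟩
  · ext z
    constructor
    · rintro ⟨h | h, hz⟩
      · exact absurd hz (hK.disj z h)
      · exact honly L₁ hL₁ hLK₁ z hz (hatt L₁ hL₁ hLK₁ z hz h.2)
    · rintro (rfl | rfl)
      · exact ⟨Or.inr ⟨hu, huk⟩, hu⟩
      · exact ⟨Or.inr ⟨hw, hwk⟩, hw⟩
  intro B' hB' hne'
  obtain ⟨L, hL, rfl⟩ := bridge_comp hind hB'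
  have hLK : L ≠ K := by rintro rfl; exact hne' rfl
  obtain ⟨x₀, hx₀, hux⟩ := hatt L hL hLK u hu huk
  obtain ⟨y₀, hy₀, hwy⟩ := hatt L hL hLK w hw hwk
  have hux' : ∀ k ∈ L, G.Adj u k → k = x₀ := fun k hk h =>
    (huniq L hL hLK w hw hwk k hk x₀ hx₀ u hu u hu huw huw h hux).1
  have hwy' : ∀ k ∈ L, G.Adj w k → k = y₀ := fun k hk h =>
    (huniq L hL hLK u hu huk k hk y₀ hy₀ w hw w hw huw.symm huw.symm h hwy).1
  have hLac : (resG G L).IsAcyclic := by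
    refine (hacy L hL hLK u hu huk).anti ?_
    exact fun x y h => ⟨h.1, Or.inl h.2.1, Or.inl h.2.2⟩
  obtain ⟨q, hq⟩ := (hL.conn x₀ hx₀ y₀ hy₀).exists_isPath
  have hqe := edge_on_path h2 hL hLac hu (x₀ := x₀) (y₀ := y₀) (by
    intro k hk z hz hkz
    rcases honly L hL hLK z hz ⟨k, hk, hkz.symm⟩ with rfl | rfl
    · exact Or.inl (hux' k hk hkz.symm)
    · exact Or.inr (hwy' k hk hkz.symm)) q
  have hqs : ∀ z, z ∈ q.support ↔ z ∈ L := by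
    intro z
    refine ⟨walk_support_resG q hx₀ z, fun hz => ?_⟩
    obtain ⟨r⟩ := hL.conn z hz x₀ hx₀
    cases r with
    | nil => simp
    | cons h r => exact q.fst_mem_support_of_mem_edges (hqe _ _ h)
  set q' := q.mapLe (resG_le G L) with hq'
  have hqs' : ∀ z, z ∈ q'.support ↔ z ∈ L := by
    intro z; rw [hq', Walk.support_mapLe_eq_support, hqs]
  have hqe' : ∀ a b, s(a, b) ∈ q'.edges ↔ (resG G L).Adj a b := by
    intro a b
    rw [hq', Walk.edges_mapLe_eq_edges]
    exact ⟨fun h => q.adj_of_mem_edges h, hqe a b⟩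
  have hq'p : q'.IsPath := hq.mapLe _
  refine ⟨Walk.cons hux (q'.concat hwy.symm), ?_, ?_⟩
  · rw [Walk.cons_isPath_iff]
    refine ⟨hq'p.concat (fun h => hL.disj w ((hqs' w).1 h) hw) _, ?_⟩
    rw [Walk.support_concat]
    simp only [List.concat_eq_append, List.mem_append, List.mem_singleton, not_or]
    exact ⟨fun h => hL.disj u ((hqs' u).1 h) hu, huw⟩
  · apply Subgraph.ext
    · ext z
      rw [Walk.mem_verts_toSubgraph, Walk.support_cons, Walk.support_concat]
      simp only [List.concat_eq_append, List.mem_append, List.not_mem_nil, or_false, List.mem_cons, hqs']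
      constructor
      · rintro (rfl | h | rfl)
        · exact Or.inr ⟨hu, x₀, hx₀, hux⟩
        · exact Or.inl h
        · exact Or.inr ⟨hw, y₀, hy₀, hwy⟩
      · rintro (h | ⟨hz, h⟩)
        · exact Or.inr (Or.inl h)
        · rcases honly L hL hLK z hz h with rfl | rfl
          · exact Or.inl rfl
          · exact Or.inr (Or.inr rfl)
    · ext a b
      rw [Walk.adj_toSubgraph_iff_mem_edges, Walk.edges_cons, Walk.edges_concat]
      simp only [List.concat_eq_append, List.mem_append, List.not_mem_nil, or_false, List.mem_cons, hqe',
        Sym2.eq_iff]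
      constructor
      · rintro ((⟨rfl, rfl⟩ | ⟨rfl, rfl⟩) | h | (⟨rfl, rfl⟩ | ⟨rfl, rfl⟩))
        · exact ⟨hux, Or.inr (Or.inr ⟨hu, hx₀⟩)⟩
        · exact ⟨hux.symm, Or.inr (Or.inl ⟨hx₀, hu⟩)⟩
        · exact ⟨h.1, Or.inl h.2⟩
        · exact ⟨hwy.symm, Or.inr (Or.inl ⟨hy₀, hw⟩)⟩
        · exact ⟨hwy, Or.inr (Or.inr ⟨hw, hy₀⟩)⟩
      · rintro ⟨hab, h | ⟨ha, hb⟩ | ⟨ha, hb⟩⟩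
        · exact Or.inr (Or.inl ⟨hab, h⟩)
        · rcases honly L hL hLK b hb ⟨a, ha, hab.symm⟩ with rfl | rfl
          · exact Or.inl (Or.inr ⟨hux' a ha hab.symm, rfl⟩)
          · exact Or.inr (Or.inr (Or.inl ⟨hwy' a ha hab.symm, rfl⟩))
        · rcases honly L hL hLK a ha ⟨b, hb, hab⟩ with rfl | rfl
          · exact Or.inl (Or.inl ⟨rfl, hux' b hb hab⟩)
          · exact Or.inr (Or.inr (Or.inr ⟨rfl, hwy' b hb hab⟩))
end
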